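/- arXiv:2302.13723 — 3 statements merged into one kernel-verified Lean document; each statement's English description precedes it below -/
import Mathlib

section
/- Let f ∈ BMO(ℝⁿ) (i.e. f locally integrable with ‖f‖_{BMO(ℝⁿ)} < ∞) satisfy lim_{δ→0} ω(f,δ) = 0, where ω(f,δ) = sup{ O(f,Q) : Q a closed axis-parallel cube with side length 0 < l(Q) ≤ δ }. Suppose the uncentered Hardy–Littlewood maximal function Mf is not identically equal to +∞. Then Mf is finite almost everywhere, Mf ∈ BMO(ℝⁿ), and lim_{δ→0} ω(Mf,δ) = 0. -/
open MeasureTheory Set Filter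
open scoped ENNReal Topology

/-- Mean oscillation of `f` over `A ⊆ ℝⁿ`. -/
noncomputable def oscN {n : ℕ} (f : (Fin n → ℝ) → ℝ) (A : Set (Fin n → ℝ)) : ℝ :=
  ⨍ x in A, |f x - ⨍ y in A, f y|

/-- The closed axis-parallel cube with lower corner `a` and side length `l`. -/
def cube {n : ℕ} (a : Fin n → ℝ) (l : ℝ) : Set (Fin n → ℝ) :=
  Set.Icc a (fun i => a i + l)

/-- BMO(ℝⁿ) seminorm. -/
noncomputable def bmoN {n : ℕ} (f : (Fin n → ℝ) → ℝ) : ℝ≥0∞ :=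
  ⨆ (a : Fin n → ℝ) (l : ℝ) (_ : 0 < l), ENNReal.ofReal (oscN f (cube a l))

/-- Modulus of mean oscillation `ω(f, δ)`: supremum of `O(f,Q)` over cubes of side
length at most `δ`. -/
noncomputable def oscMod {n : ℕ} (f : (Fin n → ℝ) → ℝ) (δ : ℝ) : ℝ≥0∞ :=
  ⨆ (a : Fin n → ℝ) (l : ℝ) (_ : 0 < l) (_ : l ≤ δ), ENNReal.ofReal (oscN f (cube a l))

/-- The uncentered Hardy–Littlewood maximal function, with values in `[0,∞]`. -/
noncomputable def maxOpN {n : ℕ} (f : (Fin n → ℝ) → ℝ) (x : Fin n → ℝ) : ℝ≥0∞ :=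
  ⨆ (a : Fin n → ℝ) (l : ℝ) (_ : 0 < l) (_ : x ∈ cube a l),
    ENNReal.ofReal (⨍ t in cube a l, |f t|)

/-- Average over the sup-norm closed ball. -/
noncomputable def av {n : ℕ} (f : (Fin n → ℝ) → ℝ) (c : Fin n → ℝ) (r : ℝ) : ℝ :=
  ⨍ x in Metric.closedBall c r, f x

lemma vol_cb {n : ℕ} (c : Fin n → ℝ) {r : ℝ} (hr : 0 < r) :
    volume (Metric.closedBall c r) = ENNReal.ofReal ((2 * r) ^ n) := by
  rw [Real.volume_pi_closedBall c hr.le]; simp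

lemma volr_cb {n : ℕ} (c : Fin n → ℝ) {r : ℝ} (hr : 0 < r) :
    volume.real (Metric.closedBall c r) = (2 * r) ^ n := by
  rw [Measure.real, vol_cb c hr, ENNReal.toReal_ofReal (by positivity)]

lemma int_cb {n : ℕ} {f : (Fin n → ℝ) → ℝ} (hf : LocallyIntegrable f volume)
    (c : Fin n → ℝ) (r : ℝ) : IntegrableOn f (Metric.closedBall c r) :=
  hf.integrableOn_isCompact (isCompact_closedBall c r)

lemma int_abs_cb {n : ℕ} {f : (Fin n → ℝ) → ℝ} {c : Fin n → ℝ} {r : ℝ}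
    (hf : IntegrableOn f (Metric.closedBall c r))
    (k : ℝ) : IntegrableOn (fun x => |f x - k|) (Metric.closedBall c r) := by
  have : IntegrableOn (fun x => f x - k) (Metric.closedBall c r) :=
    hf.sub (integrableOn_const (isCompact_closedBall c r).measure_lt_top.ne)
  exact this.abs

lemma av_eq {n : ℕ} (f : (Fin n → ℝ) → ℝ) (c : Fin n → ℝ) {r : ℝ} (hr : 0 < r) :
    av f c r = (∫ x in Metric.closedBall c r, f x) / (2 * r) ^ n := by
  rw [av, setAverage_eq, volr_cb c hr, smul_eq_mul]; ring

lemma av_mul {n : ℕ} (f : (Fin n → ℝ) → ℝ) (c : Fin n → ℝ) {r : ℝ} (hr : 0 < r) :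
    (∫ x in Metric.closedBall c r, f x) = av f c r * (2 * r) ^ n := by
  rw [av_eq f c hr]; field_simp

lemma int_sub_const {n : ℕ} {f : (Fin n → ℝ) → ℝ} {c : Fin n → ℝ} {r : ℝ} (hr : 0 < r)
    (hf : IntegrableOn f (Metric.closedBall c r)) (k : ℝ) :
    (∫ x in Metric.closedBall c r, (f x - k)) = (av f c r - k) * (2 * r) ^ n := by
  rw [integral_sub hf (integrableOn_const (isCompact_closedBall c r).measure_lt_top.ne),
    av_mul f c hr, setIntegral_const, volr_cb c hr, smul_eq_mul]
  ring

/-- averages over sub-balls. -/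
lemma av_sub_le {n : ℕ} {f : (Fin n → ℝ) → ℝ} {c d : Fin n → ℝ} {r s : ℝ} (hr : 0 < r) 
    (hf : IntegrableOn f (Metric.closedBall d s))
    (h : Metric.closedBall c r ⊆ Metric.closedBall d s) (k : ℝ) :
    |av f c r - k| * (2 * r) ^ n ≤ ∫ x in Metric.closedBall d s, |f x - k| := by
  have h1 : |av f c r - k| * (2 * r) ^ n = |∫ x in Metric.closedBall c r, (f x - k)| := by
    rw [int_sub_const hr (hf.mono_set h), abs_mul, abs_of_pos (a := (2 * r) ^ n) (by positivity)]
  rw [h1]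
  refine abs_integral_le_integral_abs.trans ?_
  exact setIntegral_mono_set (int_abs_cb hf k) (ae_of_all _ fun x => abs_nonneg _)
    h.eventuallyLE

lemma osc_eq {n : ℕ} (f : (Fin n → ℝ) → ℝ) (c : Fin n → ℝ) {r : ℝ} (hr : 0 < r) :
    (∫ x in Metric.closedBall c r, |f x - av f c r|)
      = oscN f (Metric.closedBall c r) * (2 * r) ^ n := by
  rw [av_mul _ c hr]; rfl

lemma osc_le_two {n : ℕ} {f : (Fin n → ℝ) → ℝ} {c : Fin n → ℝ} {r : ℝ} (hr : 0 < r)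
    (hf : IntegrableOn f (Metric.closedBall c r)) (k : ℝ) :
    oscN f (Metric.closedBall c r) * (2 * r) ^ n
      ≤ 2 * ∫ x in Metric.closedBall c r, |f x - k| := by
  rw [← osc_eq f c hr]
  have h2 := av_sub_le hr hf le_rfl k
  have : (∫ x in Metric.closedBall c r, |f x - av f c r|) ≤
      ∫ x in Metric.closedBall c r, (|f x - k| + |av f c r - k|) := by
    refine integral_mono (int_abs_cb hf _) ((int_abs_cb hf k).add
      (integrableOn_const (isCompact_closedBall c r).measure_lt_top.ne)) fun x => ?_
    have := abs_sub_le (f x) k (av f c r)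
    rwa [abs_sub_comm k] at this
  rw [integral_add (int_abs_cb hf k)
      (integrableOn_const (isCompact_closedBall c r).measure_lt_top.ne),
    setIntegral_const, volr_cb c hr, smul_eq_mul] at this
  linarith

lemma osc_abs {n : ℕ} {f : (Fin n → ℝ) → ℝ} {c : Fin n → ℝ} {r : ℝ} (hr : 0 < r)
    (hf : IntegrableOn f (Metric.closedBall c r)) :
    oscN (fun x => |f x|) (Metric.closedBall c r) ≤ 2 * oscN f (Metric.closedBall c r) := by
  have h1 := osc_le_two hr hf.abs (|av f c r|)
  have h2 : (∫ x in Metric.closedBall c r, abs (|f x| - |av f c r|)) ≤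
      ∫ x in Metric.closedBall c r, |f x - av f c r| :=
    integral_mono (int_abs_cb hf.abs _) (int_abs_cb hf _) fun x => abs_abs_sub_abs_le _ _
  rw [osc_eq f c hr] at h2
  have : (0:ℝ) < (2 * r) ^ n := by positivity
  refine le_of_mul_le_mul_right ?_ this
  linarith

lemma osc_neg {n : ℕ} {f : (Fin n → ℝ) → ℝ} (A : Set (Fin n → ℝ)) :
    oscN (fun x => - f x) A = oscN f A := by
  unfold oscN
  have : (⨍ y in A, - f y) = - ⨍ y in A, f y := by
    rw [setAverage_eq, setAverage_eq, integral_neg, smul_neg]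
  rw [this]
  congr 1; ext x
  rw [← abs_neg]; congr 1; ring

lemma cube_eq {n : ℕ} (a : Fin n → ℝ) {l : ℝ} (hl : 0 < l) :
    cube a l = Metric.closedBall (fun i => a i + l / 2) (l / 2) := by
  rw [closedBall_pi _ (by positivity), cube, ← Set.pi_univ_Icc]
  congr 1; ext i x
  rw [Real.closedBall_eq_Icc]
  simp only [mem_Icc]
  constructor <;> rintro ⟨h1, h2⟩ <;> constructor <;> linarith

lemma cb_eq {n : ℕ} (c : Fin n → ℝ) {r : ℝ} (hr : 0 < r) :
    Metric.closedBall c r = cube (fun i => c i - r) (2 * r) := by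
  rw [cube_eq _ (by positivity)]
  congr 1
  · ext i; ring
  · ring

lemma rad_le {n : ℕ} (hn : 1 ≤ n) {c d : Fin n → ℝ} {r s : ℝ} (hr : 0 < r) (hs : 0 < s)
    (h : Metric.closedBall c r ⊆ Metric.closedBall d s) : r ≤ s := by
  have := measure_mono (μ := volume) h
  rw [vol_cb c hr, vol_cb d hs, ENNReal.ofReal_le_ofReal_iff (by positivity)] at this
  have := (pow_le_pow_iff_left₀ (by positivity) (by positivity) (by omega : n ≠ 0)).1 this
  linarith

/-- Bad set. -/
def badE {n : ℕ} (f : (Fin n → ℝ) → ℝ) (c : Fin n → ℝ) (r t : ℝ) : Set (Fin n → ℝ) :=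
  {x | x ∈ Metric.closedBall c r ∧ ∃ d s, 0 < s ∧ s ≤ r ∧ x ∈ Metric.closedBall d s ∧
    av f c r + t < av f d s}

lemma sum_est {n : ℕ} {f : (Fin n → ℝ) → ℝ} (hf : LocallyIntegrable f volume)
    {w ρ : ℝ} (hw : 0 < w)
    (hosc : ∀ c r, 0 < r → r ≤ ρ → oscN f (Metric.closedBall c r) ≤ w)
    (c : Fin n → ℝ) {r : ℝ} (hr : 0 < r) (hrρ : 3 * r ≤ ρ) :
    (∫ x in Metric.closedBall c (3 * r), |f x - av f c r|) ≤ 2 * 9 ^ n * w * (2 * r) ^ n := by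
  have h3 : 0 < 3 * r := by positivity
  have hI := int_cb hf c (3 * r)
  have h1 := osc_eq f c h3
  have h2 := hosc c (3 * r) h3 hrρ
  have hp : (0:ℝ) < (2 * (3 * r)) ^ n := by positivity
  have hp' : (0:ℝ) < (2 * r) ^ n := by positivity
  have e : (2 * (3 * r)) ^ n = 3 ^ n * (2 * r) ^ n := by rw [← mul_pow]; ring
  have h4 := av_sub_le hr hI (Metric.closedBall_subset_closedBall (by linarith)) (av f c (3 * r))
  rw [h1] at h4
  have h5 : |av f c r - av f c (3 * r)| ≤ 3 ^ n * w := by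
    refine le_of_mul_le_mul_right (h4.trans ?_) hp'
    rw [e]
    have := mul_le_mul_of_nonneg_right h2 (by positivity : 0 ≤ 3 ^ n * (2 * r) ^ n)
    linarith
  have h6 : (∫ x in Metric.closedBall c (3 * r), |f x - av f c r|) ≤
      ∫ x in Metric.closedBall c (3 * r), (|f x - av f c (3 * r)| + 3 ^ n * w) := by
    refine integral_mono (int_abs_cb hI _) ((int_abs_cb hI _).add
      (integrableOn_const (isCompact_closedBall c _).measure_lt_top.ne)) fun x => ?_
    have := abs_sub_le (f x) (av f c (3 * r)) (av f c r)
    rw [abs_sub_comm (av f c (3 * r))] at this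
    exact this.trans (by gcongr)
  rw [integral_add (int_abs_cb hI _)
      (integrableOn_const (isCompact_closedBall c _).measure_lt_top.ne),
    setIntegral_const, volr_cb c h3, smul_eq_mul, h1, e] at h6
  refine h6.trans ?_
  have h7 : (1:ℝ) ≤ 3 ^ n := one_le_pow₀ (by norm_num)
  have e9 : (9:ℝ) ^ n = 3 ^ n * 3 ^ n := by rw [← mul_pow]; norm_num
  rw [e9]
  have a1 : oscN f (Metric.closedBall c (3 * r)) * (3 ^ n * (2 * r) ^ n)
      ≤ w * (3 ^ n * (2 * r) ^ n) := by gcongr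
  have a2 : w * (3 ^ n * (2 * r) ^ n) * 1 ≤ w * (3 ^ n * (2 * r) ^ n) * 3 ^ n := by gcongr
  nlinarith [a1, a2]

lemma badE_decay {n : ℕ} (hn : 1 ≤ n) {f : (Fin n → ℝ) → ℝ} (hf : LocallyIntegrable f volume)
    {w ρ : ℝ} (hw : 0 < w)
    (hosc : ∀ c r, 0 < r → r ≤ ρ → oscN f (Metric.closedBall c r) ≤ w) (k : ℕ) :
    ∀ (c : Fin n → ℝ) (r : ℝ), 0 < r → 3 * r ≤ ρ →
      volume (badE f c r (k * (4 * 45 ^ n * w))) ≤ (2⁻¹ : ℝ≥0∞) ^ k * volume (Metric.closedBall c r) := by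
  induction k with
  | zero =>
    intro c r hr hrρ
    simp only [pow_zero, one_mul]
    exact measure_mono fun x hx => hx.1
  | succ k ih =>
    intro c r hr hrρ
    set T : ℝ := 4 * 45 ^ n * w with hT
    have hTpos : 0 < T := by positivity
    have hsum := sum_est hf hw hosc c hr hrρ
    have hp' : (0:ℝ) < (2 * r) ^ n := by positivity
    have e45 : (45:ℝ) ^ n = 5 ^ n * 9 ^ n := by rw [← mul_pow]; norm_num
    -- single ball is small
    have hsmall : ∀ d s, 0 < s → s ≤ r → (Metric.closedBall d s ∩ Metric.closedBall c r).Nonempty →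
        av f c r + T < av f d s → 5 * s ≤ r := by
      intro d s hs hsr hne hlt
      have hsub : Metric.closedBall d s ⊆ Metric.closedBall c (3 * r) := by
        obtain ⟨z, hz1, hz2⟩ := hne
        apply Metric.closedBall_subset_closedBall'
        have := dist_triangle_left d c z
        rw [Metric.mem_closedBall] at hz1 hz2
        linarith
      have h1 := av_sub_le hs (int_cb hf c (3 * r)) hsub (av f c r)
      have h2 : T ≤ |av f d s - av f c r| := le_trans (by linarith) (le_abs_self _)
      have h3 : T * (2 * s) ^ n ≤ 2 * 9 ^ n * w * (2 * r) ^ n := by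
        refine le_trans ?_ (h1.trans hsum); gcongr
      have h4 : (5 * s) ^ n ≤ r ^ n := by
        rw [hT, e45, mul_pow, mul_pow] at h3
        rw [mul_pow]
        have hq : (0:ℝ) < 2 * 9 ^ n * w * 2 ^ n := by positivity
        refine le_of_mul_le_mul_left ?_ hq
        have : 0 ≤ 2 * 9 ^ n * w * 2 ^ n * (5 ^ n * s ^ n) := by positivity
        nlinarith
      exact (pow_le_pow_iff_left₀ (by positivity) hr.le (by omega : n ≠ 0)).1 h4
    let F : Set ((Fin n → ℝ) × ℝ) := {p | 0 < p.2 ∧ p.2 ≤ r ∧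
      (Metric.closedBall p.1 p.2 ∩ Metric.closedBall c r).Nonempty ∧
      av f c r + T < av f p.1 p.2 ∧ av f p.1 (5 * p.2) ≤ av f c r + T}
    obtain ⟨u, huF, hudisj, hucov⟩ :=
      Vitali.exists_disjoint_subfamily_covering_enlargement_closedBall F
        (fun p => p.1) (fun p => p.2) r (fun p hp => hp.2.1) 5 (by norm_num)
    have hucount : u.Countable := by
      refine hudisj.countable_of_nonempty_interior fun p hp => ?_
      refine ⟨p.1, ?_⟩
      exact Metric.ball_subset_interior_closedBall (Metric.mem_ball_self (huF hp).1)
    have hcover : badE f c r ((k + 1 : ℕ) * T) ⊆ ⋃ p ∈ u, badE f p.1 (5 * p.2) (k * T) := by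
      rintro x ⟨hxc, d, s, hs, hsr, hxd, hlt⟩
      have hkT : T ≤ ((k + 1 : ℕ) : ℝ) * T := by
        push_cast
        have : 0 ≤ (k:ℝ) * T := by positivity
        linarith
      let P : ℕ → Prop := fun j => 5 ^ j * s ≤ r ∧ av f c r + T < av f d (5 ^ j * s)
      have hP0 : P 0 := ⟨by simpa using hsr, by simp; linarith⟩
      have hex : ∃ j, ¬ P j := by
        obtain ⟨j, hj⟩ := pow_unbounded_of_one_lt (r / s) (by norm_num : (1:ℝ) < 5)
        refine ⟨j, fun h => ?_⟩
        rw [div_lt_iff₀ hs] at hj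
        linarith [h.1]
      classical
      obtain ⟨j, hj1, hj2⟩ : ∃ j, P j ∧ ¬ P (j + 1) := by
        by_contra hcon
        push Not at hcon
        obtain ⟨j, hj⟩ := hex
        exact hj (Nat.rec hP0 (fun i hi => hcon i hi) j)
      have hsj : 0 < 5 ^ j * s := by positivity
      have hsub : Metric.closedBall d s ⊆ Metric.closedBall d (5 ^ j * s) := by
        apply Metric.closedBall_subset_closedBall
        have : (1:ℝ) ≤ 5 ^ j := one_le_pow₀ (by norm_num)
        nlinarith
      have hne : (Metric.closedBall d (5 ^ j * s) ∩ Metric.closedBall c r).Nonempty :=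
        ⟨x, hsub hxd, hxc⟩
      have h5 := hsmall d _ hsj hj1.1 hne hj1.2
      have e5 : 5 ^ (j + 1) * s = 5 * (5 ^ j * s) := by ring
      have hmem : (d, 5 ^ j * s) ∈ F := by
        refine ⟨hsj, hj1.1, hne, hj1.2, ?_⟩
        by_contra hcon
        push Not at hcon
        apply hj2
        refine ⟨?_, ?_⟩
        · rw [e5]; exact h5
        · rw [e5]; exact hcon
      obtain ⟨p, hpu, hpsub⟩ := hucov _ hmem
      have hpF := huF hpu
      refine mem_iUnion₂.2 ⟨p, hpu, hpsub (hsub hxd), d, s, hs, ?_, hxd, ?_⟩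
      · exact rad_le hn hs (by linarith [hpF.1]) (hsub.trans hpsub)
      · have := hpF.2.2.2.2
        push_cast at hlt
        linarith
    have hsumvol : (∑' p : u, volume (Metric.closedBall p.1.1 p.1.2)) * ENNReal.ofReal T
        ≤ ENNReal.ofReal (2 * 9 ^ n * w * (2 * r) ^ n) := by
      have hsub : ∀ p ∈ u, Metric.closedBall p.1 p.2 ⊆ Metric.closedBall c (3 * r) := by
        intro p hp
        obtain ⟨h0, h1, ⟨z, hz1, hz2⟩, -⟩ := huF hp
        apply Metric.closedBall_subset_closedBall'
        have := dist_triangle_left p.1 c z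
        rw [Metric.mem_closedBall] at hz1 hz2
        linarith
      calc (∑' p : u, volume (Metric.closedBall p.1.1 p.1.2)) * ENNReal.ofReal T
          = ∑' p : u, volume (Metric.closedBall p.1.1 p.1.2) * ENNReal.ofReal T :=
            ENNReal.tsum_mul_right.symm
        _ ≤ ∑' p : u, ∫⁻ x in Metric.closedBall p.1.1 p.1.2, ENNReal.ofReal |f x - av f c r| := by
            refine ENNReal.tsum_le_tsum fun p => ?_
            obtain ⟨h0, h1, h2, h3, -⟩ := huF p.2
            rw [← ofReal_integral_eq_lintegral_ofReal (int_abs_cb (int_cb hf _ _) _)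
              (ae_of_all _ fun x => abs_nonneg _), vol_cb _ h0,
              ← ENNReal.ofReal_mul (by positivity)]
            apply ENNReal.ofReal_le_ofReal
            have h4 := av_sub_le h0 (int_cb hf p.1.1 p.1.2) le_rfl (av f c r)
            refine le_trans ?_ h4
            rw [mul_comm]
            gcongr
            exact le_trans (by linarith) (le_abs_self _)
        _ = ∫⁻ x in ⋃ p ∈ u, Metric.closedBall p.1 p.2, ENNReal.ofReal |f x - av f c r| :=
            (lintegral_biUnion hucount (fun p _ => Metric.isClosed_closedBall.measurableSet)
              hudisj _).symm
        _ ≤ ∫⁻ x in Metric.closedBall c (3 * r), ENNReal.ofReal |f x - av f c r| :=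
            lintegral_mono_set (iUnion₂_subset hsub)
        _ ≤ _ := by
            rw [← ofReal_integral_eq_lintegral_ofReal (int_abs_cb (int_cb hf _ _) _)
              (ae_of_all _ fun x => abs_nonneg _)]
            exact ENNReal.ofReal_le_ofReal hsum
    have hsumvol2 : ENNReal.ofReal (5 ^ n) * (∑' p : u, volume (Metric.closedBall p.1.1 p.1.2))
        ≤ 2⁻¹ * volume (Metric.closedBall c r) := by
      have hT0 : ENNReal.ofReal T ≠ 0 := by simpa using hTpos
      rw [← ENNReal.mul_le_mul_iff_left hT0 ENNReal.ofReal_ne_top, mul_assoc]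
      refine (mul_le_mul_right hsumvol _).trans (le_of_eq ?_)
      have : (2⁻¹ : ℝ≥0∞) = ENNReal.ofReal (2⁻¹) := by
        rw [ENNReal.ofReal_inv_of_pos (by norm_num)]; simp
      rw [this, vol_cb c hr, ← ENNReal.ofReal_mul (by positivity), ← ENNReal.ofReal_mul (by positivity),
        ← ENNReal.ofReal_mul (by positivity)]
      congr 1
      rw [hT, e45]; ring
    calc volume (badE f c r ((k + 1 : ℕ) * T))
        ≤ volume (⋃ p ∈ u, badE f p.1 (5 * p.2) (k * T)) := measure_mono hcover
      _ ≤ ∑' p : u, volume (badE f p.1.1 (5 * p.1.2) (k * T)) := measure_biUnion_le _ hucount _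
      _ ≤ ∑' p : u, (2⁻¹ : ℝ≥0∞) ^ k * (ENNReal.ofReal (5 ^ n) * volume (Metric.closedBall p.1.1 p.1.2)) := by
          refine ENNReal.tsum_le_tsum fun p => ?_
          obtain ⟨h0, h1, h2, h3, -⟩ := huF p.2
          have h5 := hsmall _ _ h0 h1 h2 h3
          refine (ih p.1.1 (5 * p.1.2) (by positivity) (by linarith)).trans (le_of_eq ?_)
          rw [vol_cb _ h0, vol_cb _ (by positivity), ← ENNReal.ofReal_mul (by positivity), ← mul_pow]
          ring_nf
      _ = (2⁻¹ : ℝ≥0∞) ^ k * (ENNReal.ofReal (5 ^ n) * ∑' p : u, volume (Metric.closedBall p.1.1 p.1.2)) := by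
          rw [ENNReal.tsum_mul_left, ENNReal.tsum_mul_left]
      _ ≤ (2⁻¹ : ℝ≥0∞) ^ k * (2⁻¹ * volume (Metric.closedBall c r)) := by gcongr
      _ = _ := by rw [pow_succ, mul_assoc]

/-- Layer-cake in geometric form. -/
lemma layer {α : Type*} [MeasurableSpace α] {μ : Measure α} {h : α → ℝ≥0∞} (hh : AEMeasurable h μ)
    {t V : ℝ≥0∞} (hd : ∀ k : ℕ, μ {x | k * t < h x} ≤ (2⁻¹ : ℝ≥0∞) ^ k * V) (ht : t ≠ 0) :
    ∫⁻ x, h x ∂μ ≤ 2 * t * V := by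
  have key : ∀ x, h x ≤ ∑' k : ℕ, {x | k * t < h x}.indicator (fun _ => t) x := by
    intro x
    have h1 : ∀ N : ℕ, min (h x) (N * t) ≤
        ∑ k ∈ Finset.range N, {x | k * t < h x}.indicator (fun _ => t) x := by
      intro N
      induction N with
      | zero => simp
      | succ N ih =>
        rw [Finset.sum_range_succ]
        by_cases hx : N * t < h x
        · rw [min_eq_right hx.le] at ih
          rw [indicator_of_mem (by exact hx)]
          refine (min_le_right _ _).trans ?_
          push_cast
          rw [add_mul, one_mul]
          gcongr
        · rw [min_eq_left (not_lt.1 hx)] at ih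
          exact (min_le_left _ _).trans (ih.trans le_self_add)
    refine le_of_forall_lt fun b hb => ?_
    obtain ⟨N, hN⟩ := ENNReal.exists_nat_mul_gt ht hb.ne_top
    calc b < min (h x) (N * t) := lt_min hb hN
      _ ≤ _ := h1 N
      _ ≤ _ := ENNReal.sum_le_tsum _
  calc ∫⁻ x, h x ∂μ ≤ ∫⁻ x, ∑' k : ℕ, {x | k * t < h x}.indicator (fun _ => t) x ∂μ :=
        lintegral_mono key
    _ = ∑' k : ℕ, ∫⁻ x, {x | k * t < h x}.indicator (fun _ => t) x ∂μ := by
        refine lintegral_tsum fun k => ?_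
        exact aemeasurable_const.indicator₀ (nullMeasurableSet_lt aemeasurable_const hh)
    _ ≤ ∑' k : ℕ, (2⁻¹ : ℝ≥0∞) ^ k * (V * t) := by
        refine ENNReal.tsum_le_tsum fun k => ?_
        refine (lintegral_indicator_const_le _ _).trans ?_
        rw [mul_comm, ← mul_assoc]
        gcongr
        exact hd k
    _ = _ := by
        rw [ENNReal.tsum_mul_right, ENNReal.tsum_geometric]
        have : (1 - 2⁻¹ : ℝ≥0∞)⁻¹ = 2 := by rw [ENNReal.one_sub_inv_two, inv_inv]
        rw [this]; ring

lemma jn {n : ℕ} (hn : 1 ≤ n) {f : (Fin n → ℝ) → ℝ} (hf : LocallyIntegrable f volume)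
    {w ρ : ℝ} (hw : 0 < w)
    (hosc : ∀ c r, 0 < r → r ≤ ρ → oscN f (Metric.closedBall c r) ≤ w) (k : ℕ)
    (c : Fin n → ℝ) (r : ℝ) (hr : 0 < r) (hrρ : 3 * r ≤ ρ) :
    volume {x | x ∈ Metric.closedBall c r ∧ av f c r + k * (4 * 45 ^ n * w) < f x}
      ≤ (2⁻¹ : ℝ≥0∞) ^ k * volume (Metric.closedBall c r) := by
  refine le_trans (measure_mono_ae ?_) (badE_decay hn hf hw hosc k c r hr hrρ)
  filter_upwards [IsUnifLocDoublingMeasure.ae_tendsto_average volume hf 1] with x hx hx2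
  obtain ⟨hx2, hx3⟩ := hx2
  have h1 := hx (ι := ℝ) (l := 𝓝[>] 0) (fun _ => x) (fun s => s) tendsto_id (by
    filter_upwards [self_mem_nhdsWithin] with s hs
    have : (0:ℝ) < s := hs
    simpa using this.le)
  have h2 := h1.eventually (lt_mem_nhds hx3)
  have h3 : ∀ᶠ s : ℝ in 𝓝[>] 0, s ≤ r := by
    filter_upwards [Ioc_mem_nhdsGT hr] with s hs using hs.2
  have h4 : ∀ᶠ s : ℝ in 𝓝[>] 0, 0 < s := self_mem_nhdsWithin
  obtain ⟨s, hs1, hs2, hs3⟩ := (h2.and (h3.and h4)).exists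
  exact ⟨hx2, x, s, hs3, hs2, Metric.mem_closedBall_self hs3.le, hs1⟩

lemma enlarge_aux {n : ℕ} (hn : 1 ≤ n) {f : (Fin n → ℝ) → ℝ} (hf : LocallyIntegrable f volume)
    {w : ℝ} (hw : 0 < w)
    (hosc : ∀ c r, 0 < r → oscN f (Metric.closedBall c r) ≤ w) (m : ℕ)
    (d : Fin n → ℝ) {s s' : ℝ} (hs : 0 < s) (hss : s ≤ s') :
    (av f d s - av f d s') * (2 * s) ^ n ≤
      m * (4 * 45 ^ n * w) * ((2 * s') ^ n - (2 * s) ^ n)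
        + 2 * (4 * 45 ^ n * w) * (2⁻¹ ^ m * (2 * s') ^ n) := by
  set T : ℝ := 4 * 45 ^ n * w with hT
  have hTpos : 0 < T := by positivity
  have hs' : 0 < s' := by linarith
  set A := av f d s' with hA
  set ψ : (Fin n → ℝ) → ℝ := fun x => max (A - f x - m * T) 0 with hψ
  have hI := int_cb hf d s'
  have hcst : ∀ k : ℝ, IntegrableOn (fun _ : Fin n → ℝ => k) (Metric.closedBall d s') := fun k =>
    integrableOn_const (isCompact_closedBall d s').measure_lt_top.ne
  have hψI : IntegrableOn ψ (Metric.closedBall d s') :=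
    (((hcst A).sub hI).sub (hcst _)).pos_part
  have hneg : ∀ x, av (fun x => - f x) d x = - av f d x := by
    intro x
    rw [av, av, setAverage_eq, setAverage_eq, integral_neg, smul_neg]
  have hψint : (∫ x in Metric.closedBall d s', ψ x) ≤ 2 * T * (2⁻¹ ^ m * (2 * s') ^ n) := by
    rw [← ENNReal.ofReal_le_ofReal_iff (by positivity),
      ofReal_integral_eq_lintegral_ofReal hψI (ae_of_all _ fun x => le_max_right _ _)]
    have hV : ENNReal.ofReal (2 * T * (2⁻¹ ^ m * (2 * s') ^ n)) =
        2 * ENNReal.ofReal T * ((2⁻¹ : ℝ≥0∞) ^ m * volume (Metric.closedBall d s')) := by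
      have e2 : (2⁻¹ : ℝ≥0∞) = ENNReal.ofReal (2⁻¹) := by
        rw [ENNReal.ofReal_inv_of_pos (by norm_num)]; simp
      have e3 : (2 : ℝ≥0∞) = ENNReal.ofReal 2 := by simp
      rw [vol_cb d hs', e2, e3, ← ENNReal.ofReal_pow (by positivity), ← ENNReal.ofReal_mul (by positivity),
        ← ENNReal.ofReal_mul (by positivity), ← ENNReal.ofReal_mul (by positivity)]
    rw [hV]
    refine layer hψI.1.aemeasurable.ennreal_ofReal (fun k => ?_) (by simpa using hTpos)
    have hj := jn hn hf.neg hw (ρ := 3 * s')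
      (fun c r hr _ => (osc_neg (f := f) (Metric.closedBall c r)).le.trans (hosc c r hr)) (k + m) d s' hs' le_rfl
    rw [pow_add, mul_assoc (2⁻¹ ^ k : ℝ≥0∞), ← hT] at hj
    refine le_trans ?_ hj
    rw [Measure.restrict_apply₀' Metric.isClosed_closedBall.measurableSet.nullMeasurableSet]
    refine measure_mono ?_
    rintro x ⟨hx1, hx2⟩
    refine ⟨hx2, ?_⟩
    have e : (k : ℝ≥0∞) * ENNReal.ofReal T = ENNReal.ofReal (k * T) := by
      rw [ENNReal.ofReal_mul (p := (k:ℝ)) (by positivity), ENNReal.ofReal_natCast]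
    change (k : ℝ≥0∞) * ENNReal.ofReal T < ENNReal.ofReal (ψ x) at hx1
    rw [e, ENNReal.ofReal_lt_ofReal_iff_of_nonneg (by positivity)] at hx1
    have e2 : av (-f) d s' = -A := hneg s'
    rw [e2, Pi.neg_apply]
    push_cast
    have hkT : 0 ≤ (k:ℝ) * T := by positivity
    rcases lt_max_iff.1 hx1 with h | h <;> linarith
  have hsub : Metric.closedBall d s ⊆ Metric.closedBall d s' :=
    Metric.closedBall_subset_closedBall hss
  have hall : IntegrableOn (fun x => ψ x + (f x - (A - m * T))) (Metric.closedBall d s') :=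
    hψI.add (hI.sub (hcst _))
  have h1 : (∫ x in Metric.closedBall d s, (ψ x + (f x - (A - m * T)))) ≤
      ∫ x in Metric.closedBall d s', (ψ x + (f x - (A - m * T))) := by
    refine setIntegral_mono_set hall (ae_of_all _ fun x => ?_) hsub.eventuallyLE
    have := le_max_left (A - f x - m * T) 0
    simp only [hψ, Pi.zero_apply]
    linarith
  have h2 : (∫ x in Metric.closedBall d s, (f x - (A - m * T))) ≤
      ∫ x in Metric.closedBall d s, (ψ x + (f x - (A - m * T))) := by
    refine integral_mono ((hI.sub (hcst _)).mono_set hsub) (hall.mono_set hsub) fun x => ?_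
    have := le_max_right (A - f x - m * T) 0
    simp only [hψ]
    linarith
  have hI2 : IntegrableOn (fun x => f x - (A - m * T)) (Metric.closedBall d s') := hI.sub (hcst _)
  rw [integral_add hψI hI2, int_sub_const hs' hI] at h1
  rw [int_sub_const hs (hI.mono_set hsub)] at h2
  rw [← hA] at h1
  nlinarith [h1, h2, hψint]

lemma enlarge {n : ℕ} (hn : 1 ≤ n) {f : (Fin n → ℝ) → ℝ} (hf : LocallyIntegrable f volume)
    {w : ℝ} (hw : 0 < w)
    (hosc : ∀ c r, 0 < r → oscN f (Metric.closedBall c r) ≤ w) {ε : ℝ} (hε : 0 < ε) :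
    ∃ N : ℝ, 1 ≤ N ∧ ∀ (d : Fin n → ℝ) (s q : ℝ), 0 < q → N * q ≤ s →
      av f d s ≤ av f d (s + 2 * q) + ε := by
  set T : ℝ := 4 * 45 ^ n * w with hT
  have hTpos : 0 < T := by positivity
  obtain ⟨m, hm⟩ := exists_pow_lt_of_lt_one (show 0 < ε / (8 * T) by positivity)
    (show (2⁻¹ : ℝ) < 1 by norm_num)
  have hlim : Tendsto (fun N : ℝ => (1 + 2 / N) ^ n) atTop (𝓝 1) := by
    have : Tendsto (fun N : ℝ => (1 + 2 / N) ^ n) atTop (𝓝 ((1 + 0) ^ n)) :=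
      ((tendsto_const_nhds.add (tendsto_id.const_div_atTop 2)).pow n)
    simpa using this
  have h1 : (1:ℝ) < 1 + ε / (2 * (m * T + 1)) := by
    have : 0 < ε / (2 * (m * T + 1)) := by positivity
    linarith
  obtain ⟨N, hN1, hN2, hN3⟩ := ((hlim.eventually (gt_mem_nhds h1)).and
    ((hlim.eventually (gt_mem_nhds (show (1:ℝ) < 2 by norm_num))).and (eventually_ge_atTop 1))).exists
  refine ⟨N, hN3, fun d s q hq hNs => ?_⟩
  have hs : 0 < s := by nlinarith
  have key := enlarge_aux hn hf hw hosc m d hs (show s ≤ s + 2 * q by linarith)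
  rw [← hT] at key
  set κ : ℝ := (1 + 2 / N) ^ n with hκ
  have hb : (2 * (s + 2 * q)) ^ n ≤ κ * (2 * s) ^ n := by
    rw [hκ, ← mul_pow]
    apply pow_le_pow_left₀ (by positivity)
    have : q ≤ s / N := by rw [le_div_iff₀ (by linarith)]; linarith
    have e : (1 + 2 / N) * (2 * s) = 2 * s + 4 * (s / N) := by field_simp; ring
    rw [e]; linarith
  have hp : 0 < (2 * s) ^ n := by positivity
  have hmT : 0 ≤ m * T := by positivity
  have k1 : m * T * (κ - 1) ≤ ε / 2 := by
    have : κ - 1 ≤ ε / (2 * (m * T + 1)) := by linarith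
    calc m * T * (κ - 1) ≤ m * T * (ε / (2 * (m * T + 1))) := by gcongr
      _ ≤ (m * T + 1) * (ε / (2 * (m * T + 1))) := by gcongr; linarith
      _ = ε / 2 := by field_simp
  have k2 : 2 * T * (2⁻¹ ^ m * κ) ≤ ε / 2 := by
    calc 2 * T * (2⁻¹ ^ m * κ) ≤ 2 * T * (ε / (8 * T) * 2) := by gcongr
      _ = ε / 2 := by field_simp; ring
  have : (av f d s - av f d (s + 2 * q)) * (2 * s) ^ n ≤ ε * (2 * s) ^ n := by
    refine key.trans ?_
    calc m * T * ((2 * (s + 2 * q)) ^ n - (2 * s) ^ n) + 2 * T * (2⁻¹ ^ m * (2 * (s + 2 * q)) ^ n)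
        ≤ m * T * (κ * (2 * s) ^ n - (2 * s) ^ n) + 2 * T * (2⁻¹ ^ m * (κ * (2 * s) ^ n)) := by
          gcongr
      _ = (m * T * (κ - 1) + 2 * T * (2⁻¹ ^ m * κ)) * (2 * s) ^ n := by ring
      _ ≤ _ := by gcongr; linarith
  have := le_of_mul_le_mul_right this hp
  linarith

lemma locint_abs {n : ℕ} {f : (Fin n → ℝ) → ℝ} (hf : LocallyIntegrable f volume) :
    LocallyIntegrable (fun t => |f t|) volume := by
  intro x
  obtain ⟨s, hs, h⟩ := hf x
  exact ⟨s, hs, h.abs⟩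

lemma le_maxOp {n : ℕ} (f : (Fin n → ℝ) → ℝ) {x d : Fin n → ℝ} {s : ℝ} (hs : 0 < s)
    (hx : x ∈ Metric.closedBall d s) :
    ENNReal.ofReal (av (fun t => |f t|) d s) ≤ maxOpN f x := by
  rw [cb_eq d hs] at hx
  unfold av
  rw [cb_eq d hs]
  exact le_iSup_of_le _ (le_iSup_of_le _ (le_iSup_of_le (by positivity) (le_iSup_of_le hx le_rfl)))

lemma lt_maxOp {n : ℕ} {f : (Fin n → ℝ) → ℝ} {x : Fin n → ℝ} {b : ℝ≥0∞} (hb : b < maxOpN f x) :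
    ∃ d s, 0 < s ∧ x ∈ Metric.closedBall d s ∧ b < ENNReal.ofReal (av (fun t => |f t|) d s) := by
  unfold maxOpN at hb
  simp only [lt_iSup_iff] at hb
  obtain ⟨a, l, hl, hx, h⟩ := hb
  rw [cube_eq a hl] at hx h
  exact ⟨_, _, by positivity, hx, h⟩

lemma lsc_maxOp {n : ℕ} {f : (Fin n → ℝ) → ℝ} (hf : LocallyIntegrable f volume) :
    LowerSemicontinuous (maxOpN f) := by
  intro x b hb
  obtain ⟨d, s, hs, hx, h⟩ := lt_maxOp hb
  set g : (Fin n → ℝ) → ℝ := fun t => |f t| with hg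
  have hgl : LocallyIntegrable g volume := locint_abs hf
  have hu : Tendsto (fun j : ℕ => s + 1 / ((j : ℝ) + 1)) atTop (𝓝 s) := by
    simpa using tendsto_const_nhds.add (tendsto_one_div_add_atTop_nhds_zero_nat (𝕜 := ℝ))
  have hpos : ∀ j : ℕ, 0 < 1 / ((j : ℝ) + 1) := fun j => by positivity
  have hanti : Antitone fun j : ℕ => Metric.closedBall d (s + 1 / ((j : ℝ) + 1)) := by
    intro i j hij
    apply Metric.closedBall_subset_closedBall
    gcongr
  have hinter : (⋂ j : ℕ, Metric.closedBall d (s + 1 / ((j : ℝ) + 1))) = Metric.closedBall d s := by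
    ext y
    simp only [mem_iInter, Metric.mem_closedBall]
    constructor
    · intro hy
      exact ge_of_tendsto' hu hy
    · intro hy j
      linarith [hpos j]
  have h1 := tendsto_setIntegral_of_antitone (μ := volume) (f := g)
    (fun j : ℕ => (Metric.isClosed_closedBall (x := d) (ε := s + 1 / ((j : ℝ) + 1))).measurableSet)
    hanti ⟨0, int_cb hgl _ _⟩
  rw [hinter] at h1
  have h2 : Tendsto (fun j : ℕ => av g d (s + 1 / ((j : ℝ) + 1))) atTop (𝓝 (av g d s)) := by
    rw [av_eq g d hs]
    have : (fun j : ℕ => av g d (s + 1 / ((j : ℝ) + 1))) = fun j : ℕ =>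
        (∫ x in Metric.closedBall d (s + 1 / ((j : ℝ) + 1)), g x) / (2 * (s + 1 / ((j : ℝ) + 1))) ^ n := by
      ext j
      exact av_eq g d (by linarith [hpos j])
    rw [this]
    exact h1.div ((hu.const_mul 2).pow n) (by positivity)
  have h3 := (ENNReal.continuous_ofReal.tendsto _).comp h2
  obtain ⟨j, hj⟩ := (h3.eventually (lt_mem_nhds h)).exists
  have hsj : s < s + 1 / ((j : ℝ) + 1) := by linarith [hpos j]
  have hball : Metric.ball d (s + 1 / ((j : ℝ) + 1)) ∈ 𝓝 x :=
    Metric.isOpen_ball.mem_nhds (Metric.closedBall_subset_ball hsj hx)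
  filter_upwards [hball] with y hy
  exact lt_of_lt_of_le hj (le_maxOp f (by linarith) (Metric.ball_subset_closedBall hy))

lemma core {n : ℕ} (hn : 1 ≤ n) {f : (Fin n → ℝ) → ℝ} (hf : LocallyIntegrable f volume)
    {ε N w q : ℝ} (hε : 0 < ε) (hN : 1 ≤ N) (hw : 0 < w) (hq : 0 < q)
    (henl : ∀ (d : Fin n → ℝ) (s q : ℝ), 0 < q → N * q ≤ s →
      av (fun t => |f t|) d s ≤ av (fun t => |f t|) d (s + 2 * q) + ε)
    (hosc : ∀ c r, 0 < r → r ≤ 3 * (N * q) → oscN (fun t => |f t|) (Metric.closedBall c r) ≤ w)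
    (c : Fin n → ℝ) :
    ∫⁻ x in Metric.closedBall c q, (maxOpN f x - ⨅ y ∈ Metric.closedBall c q, maxOpN f y)
      ≤ ENNReal.ofReal ((ε + 2 * (4 * 45 ^ n * w) * N ^ n) * (2 * q) ^ n) := by
  set T : ℝ := 4 * 45 ^ n * w with hT
  have hTpos : 0 < T := by positivity
  set g : (Fin n → ℝ) → ℝ := fun t => |f t| with hg
  have hgl : LocallyIntegrable g volume := locint_abs hf
  set m := ⨅ y ∈ Metric.closedBall c q, maxOpN f y with hm
  have hmeas : Measurable (maxOpN f) := (lsc_maxOp hf).measurable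
  have hNq : 0 < N * q := by positivity
  have hQ : Metric.closedBall c q ⊆ Metric.closedBall c (N * q) :=
    Metric.closedBall_subset_closedBall (by nlinarith)
  have hav : ∀ d s, 0 ≤ av g d s := by
    intro d s
    rw [av, setAverage_eq]
    exact smul_nonneg (inv_nonneg.2 measureReal_nonneg) (integral_nonneg fun x => abs_nonneg _)
  have hbad : ∀ k : ℕ, {x | x ∈ Metric.closedBall c q ∧
      k * ENNReal.ofReal T < maxOpN f x - m - ENNReal.ofReal ε} ⊆ badE g c (N * q) (k * T) := by
    rintro k y ⟨hy, hlt⟩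
    have e : (k : ℝ≥0∞) * ENNReal.ofReal T = ENNReal.ofReal (k * T) := by
      rw [ENNReal.ofReal_mul (p := (k:ℝ)) (by positivity), ENNReal.ofReal_natCast]
    rw [e, lt_tsub_iff_right, lt_tsub_iff_right] at hlt
    have hlt2 : m < maxOpN f y - (ENNReal.ofReal (k * T) + ENNReal.ofReal ε) := by
      rwa [lt_tsub_iff_left]
    rw [hm] at hlt2
    simp only [iInf_lt_iff] at hlt2
    obtain ⟨x, hx, hxy⟩ := hlt2
    rw [lt_tsub_iff_right] at hxy
    obtain ⟨d, s, hs, hyd, h⟩ := lt_maxOp hxy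
    have hkT : 0 ≤ k * T := by positivity
    have hsN : s ≤ N * q := by
      by_contra hcon
      push Not at hcon
      have h1 := henl d s q hq hcon.le
      have hxin : x ∈ Metric.closedBall d (s + 2 * q) := by
        rw [Metric.mem_closedBall] at *
        have := dist_triangle x y d
        have := dist_triangle_right x y c
        linarith
      have h2 := le_maxOp f (by linarith : 0 < s + 2 * q) hxin
      have h3 : ENNReal.ofReal (av g d s) ≤ maxOpN f x + (ENNReal.ofReal (k * T) + ENNReal.ofReal ε) := by
        calc ENNReal.ofReal (av g d s) ≤ ENNReal.ofReal (av g d (s + 2 * q) + ε) :=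
              ENNReal.ofReal_le_ofReal h1
          _ = ENNReal.ofReal (av g d (s + 2 * q)) + ENNReal.ofReal ε :=
              ENNReal.ofReal_add (hav _ _) hε.le
          _ ≤ _ := add_le_add h2 le_add_self
      exact absurd h (not_lt.2 h3)
    refine ⟨hQ hy, d, s, hs, hsN, hyd, ?_⟩
    have h4 := le_maxOp f hNq (hQ hx)
    have h5 : ENNReal.ofReal (av g c (N * q) + k * T) < ENNReal.ofReal (av g d s) := by
      rw [ENNReal.ofReal_add (hav _ _) hkT]
      refine lt_of_le_of_lt ?_ h
      exact add_le_add h4 le_self_add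
    exact (ENNReal.ofReal_lt_ofReal_iff_of_nonneg (add_nonneg (hav _ _) hkT)).1 h5
  have hint : ∫⁻ x in Metric.closedBall c q, (maxOpN f x - m - ENNReal.ofReal ε) ≤
      2 * ENNReal.ofReal T * volume (Metric.closedBall c (N * q)) := by
    refine layer ((hmeas.sub_const _).sub_const _).aemeasurable (fun k => ?_) (by simpa using hTpos)
    refine le_trans ?_ (badE_decay hn hgl hw hosc k c (N * q) hNq le_rfl)
    rw [Measure.restrict_apply₀' Metric.isClosed_closedBall.measurableSet.nullMeasurableSet]
    exact measure_mono fun x hx => hbad k ⟨hx.2, hx.1⟩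
  calc ∫⁻ x in Metric.closedBall c q, (maxOpN f x - m)
      ≤ ∫⁻ x in Metric.closedBall c q, ((maxOpN f x - m - ENNReal.ofReal ε) + ENNReal.ofReal ε) :=
        lintegral_mono fun x => le_tsub_add
    _ = (∫⁻ x in Metric.closedBall c q, (maxOpN f x - m - ENNReal.ofReal ε))
          + ENNReal.ofReal ε * volume (Metric.closedBall c q) := by
        rw [lintegral_add_right _ measurable_const, setLIntegral_const]
    _ ≤ 2 * ENNReal.ofReal T * volume (Metric.closedBall c (N * q))
          + ENNReal.ofReal ε * volume (Metric.closedBall c q) := by gcongr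
    _ = _ := by
        have e3 : (2 : ℝ≥0∞) = ENNReal.ofReal 2 := by simp
        rw [vol_cb c hq, vol_cb c hNq, e3, ← ENNReal.ofReal_mul (by positivity),
          ← ENNReal.ofReal_mul (by positivity), ← ENNReal.ofReal_mul (by positivity),
          ← ENNReal.ofReal_add (by positivity) (by positivity)]
        congr 1
        have : (2 * (N * q)) ^ n = N ^ n * (2 * q) ^ n := by rw [← mul_pow]; ring
        rw [this]; ring

lemma concl {n : ℕ} {f : (Fin n → ℝ) → ℝ} (hf : LocallyIntegrable f volume)
    {C q : ℝ} (hC : 0 ≤ C) (hq : 0 < q) (c : Fin n → ℝ)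
    (hfin : ∃ x ∈ Metric.closedBall c q, maxOpN f x ≠ ⊤)
    (h : ∫⁻ x in Metric.closedBall c q, (maxOpN f x - ⨅ y ∈ Metric.closedBall c q, maxOpN f y)
      ≤ ENNReal.ofReal (C * (2 * q) ^ n)) :
    (∀ᵐ x ∂(volume.restrict (Metric.closedBall c q)), maxOpN f x ≠ ⊤) ∧
    IntegrableOn (fun x => (maxOpN f x).toReal) (Metric.closedBall c q) ∧
    oscN (fun x => (maxOpN f x).toReal) (Metric.closedBall c q) ≤ 2 * C := by
  set m := ⨅ y ∈ Metric.closedBall c q, maxOpN f y with hm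
  have hmeas : Measurable (maxOpN f) := (lsc_maxOp hf).measurable
  have hmle : ∀ x ∈ Metric.closedBall c q, m ≤ maxOpN f x := fun x hx => iInf₂_le x hx
  have hmtop : m ≠ ⊤ := by
    obtain ⟨x, hx, hx2⟩ := hfin
    exact ne_top_of_le_ne_top hx2 (hmle x hx)
  have hintfin : ∫⁻ x in Metric.closedBall c q, maxOpN f x ≠ ⊤ := by
    have : ∫⁻ x in Metric.closedBall c q, maxOpN f x ≤
        ∫⁻ x in Metric.closedBall c q, ((maxOpN f x - m) + m) :=
      lintegral_mono fun x => le_tsub_add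
    rw [lintegral_add_right _ measurable_const, setLIntegral_const] at this
    refine ne_top_of_le_ne_top ?_ this
    refine ENNReal.add_ne_top.2 ⟨ne_top_of_le_ne_top ENNReal.ofReal_ne_top h, ?_⟩
    exact ENNReal.mul_ne_top hmtop (isCompact_closedBall c q).measure_lt_top.ne
  have hae : ∀ᵐ x ∂(volume.restrict (Metric.closedBall c q)), maxOpN f x ≠ ⊤ := by
    filter_upwards [ae_lt_top hmeas hintfin] with x hx using hx.ne
  have hI : IntegrableOn (fun x => (maxOpN f x).toReal) (Metric.closedBall c q) :=
    integrable_toReal_of_lintegral_ne_top hmeas.aemeasurable hintfin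
  refine ⟨hae, hI, ?_⟩
  have h1 := osc_le_two hq hI m.toReal
  have h2 : (∫ x in Metric.closedBall c q, |(maxOpN f x).toReal - m.toReal|) ≤ C * (2 * q) ^ n := by
    rw [← ENNReal.ofReal_le_ofReal_iff (by positivity),
      ofReal_integral_eq_lintegral_ofReal (int_abs_cb hI _) (ae_of_all _ fun x => abs_nonneg _)]
    refine le_trans (lintegral_mono_ae ?_) h
    filter_upwards [hae, ae_restrict_mem Metric.isClosed_closedBall.measurableSet] with x hx hxm
    have hle := hmle x hxm
    have := ENNReal.toReal_mono hx hle
    rw [abs_of_nonneg (by linarith), ← ENNReal.toReal_sub_of_le hle hx, ENNReal.ofReal_toReal]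
    exact ENNReal.sub_ne_top hx
  have hp : 0 < (2 * q) ^ n := by positivity
  refine le_of_mul_le_mul_right ?_ hp
  linarith

/-- if `f ∈ VMO(ℝⁿ)` (i.e. `f ∈ BMO(ℝⁿ)` and `ω(f,δ) → 0` as `δ → 0⁺`)
and `Mf` is not identically `+∞`, then `Mf` is finite a.e., `Mf ∈ BMO(ℝⁿ)`, and
`ω(Mf, δ) → 0` as `δ → 0⁺`. -/
theorem maximal_preserves_VMO {n : ℕ} (hn : 1 ≤ n)
    (f : (Fin n → ℝ) → ℝ) (hf : LocallyIntegrable f volume)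
    (hbmo : bmoN f ≠ ⊤)
    (hvmo : Tendsto (fun δ : ℝ => oscMod f δ) (𝓝[>] 0) (𝓝 0))
    (hM : ∃ x, maxOpN f x ≠ ⊤) :
    (∀ᵐ x : Fin n → ℝ, maxOpN f x ≠ ⊤) ∧
    LocallyIntegrable (fun x => (maxOpN f x).toReal) volume ∧
    bmoN (fun x => (maxOpN f x).toReal) ≠ ⊤ ∧
    Tendsto (fun δ : ℝ => oscMod (fun x => (maxOpN f x).toReal) δ) (𝓝[>] 0) (𝓝 0) := by
  have hosc0 : ∀ c r, 0 < r → oscN f (Metric.closedBall c r) ≤ (bmoN f).toReal := by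
    intro c r hr
    rw [← ENNReal.ofReal_le_iff_le_toReal hbmo, cb_eq c hr]
    exact le_iSup_of_le _ (le_iSup_of_le _ (le_iSup_of_le (by positivity) le_rfl))
  have hgl := locint_abs hf
  set w0 : ℝ := 2 * (bmoN f).toReal + 1 with hw0
  have hw0pos : 0 < w0 := by
    have := ENNReal.toReal_nonneg (a := bmoN f)
    linarith
  have hosc1 : ∀ c r, 0 < r → oscN (fun t => |f t|) (Metric.closedBall c r) ≤ w0 := by
    intro c r hr
    have h1 := osc_abs hr (int_cb hf c r)
    have h2 := hosc0 c r hr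
    linarith
  obtain ⟨N, hN1, hN⟩ := enlarge hn hgl hw0pos hosc1 one_pos
  set C : ℝ := 1 + 2 * (4 * 45 ^ n * w0) * N ^ n with hC
  have hCpos : 0 ≤ C := by positivity
  have hcore : ∀ (c : Fin n → ℝ) (q : ℝ), 0 < q → (∃ x ∈ Metric.closedBall c q, maxOpN f x ≠ ⊤) →
      (∀ᵐ x ∂(volume.restrict (Metric.closedBall c q)), maxOpN f x ≠ ⊤) ∧
      IntegrableOn (fun x => (maxOpN f x).toReal) (Metric.closedBall c q) ∧
      oscN (fun x => (maxOpN f x).toReal) (Metric.closedBall c q) ≤ 2 * C := by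
    intro c q hq hfin
    exact concl hf hCpos hq c hfin
      (core hn hf one_pos hN1 hw0pos hq hN (fun c r hr _ => hosc1 c r hr) c)
  obtain ⟨x0, hx0⟩ := hM
  have hx0c : ∀ q : ℝ, 0 < q → ∃ x ∈ Metric.closedBall x0 q, maxOpN f x ≠ ⊤ :=
    fun q hq => ⟨x0, Metric.mem_closedBall_self hq.le, hx0⟩
  have hae : ∀ᵐ x : Fin n → ℝ, maxOpN f x ≠ ⊤ := by
    have h1 : ∀ᵐ x : Fin n → ℝ, ∀ k : ℕ, x ∈ Metric.closedBall x0 ((k : ℝ) + 1) →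
        maxOpN f x ≠ ⊤ := by
      rw [ae_all_iff]
      intro k
      have hk : (0:ℝ) < (k : ℝ) + 1 := by positivity
      exact (ae_restrict_iff' Metric.isClosed_closedBall.measurableSet).1
        (hcore x0 _ hk (hx0c _ hk)).1
    filter_upwards [h1] with x hx
    obtain ⟨k, hk⟩ := exists_nat_gt (dist x x0)
    exact hx k (by rw [Metric.mem_closedBall]; linarith)
  have hpt : ∀ (c : Fin n → ℝ) (q : ℝ), 0 < q → ∃ x ∈ Metric.closedBall c q, maxOpN f x ≠ ⊤ := by
    intro c q hq
    obtain ⟨x, hx1, hx2⟩ := (Measure.dense_of_ae hae).exists_mem_open Metric.isOpen_ball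
      (⟨c, Metric.mem_ball_self hq⟩ : (Metric.ball c q).Nonempty)
    exact ⟨x, Metric.ball_subset_closedBall hx2, hx1⟩
  refine ⟨hae, ?_, ?_, ?_⟩
  · intro x
    have hd : 0 < dist x x0 + 1 := by positivity
    refine ⟨Metric.closedBall x0 (dist x x0 + 1), ?_, (hcore x0 _ hd (hx0c _ hd)).2.1⟩
    exact mem_of_superset (Metric.isOpen_ball.mem_nhds
      (show x ∈ Metric.ball x0 (dist x x0 + 1) by rw [Metric.mem_ball]; linarith))
      Metric.ball_subset_closedBall
  · refine ne_top_of_le_ne_top (b := ENNReal.ofReal (2 * C)) ENNReal.ofReal_ne_top ?_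
    refine iSup_le fun a => iSup_le fun l => iSup_le fun hl => ?_
    apply ENNReal.ofReal_le_ofReal
    rw [cube_eq a hl]
    exact (hcore _ _ (by positivity) (hpt _ _ (by positivity))).2.2
  · rw [ENNReal.tendsto_nhds_zero]
    intro ε hε
    obtain ⟨e', he1, he2⟩ := ENNReal.lt_iff_exists_nnreal_btwn.1 hε
    have he : (0:ℝ) < e' := by exact_mod_cast he1
    obtain ⟨e, hedef⟩ : ∃ e : ℝ, e = (e' : ℝ) := ⟨_, rfl⟩
    rw [← hedef] at he
    have hee : ENNReal.ofReal e ≤ ε := by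
      rw [hedef, ENNReal.ofReal_coe_nnreal]; exact he2.le
    obtain ⟨N, hN1, hN⟩ := enlarge hn hgl hw0pos hosc1 (show 0 < e / 4 by positivity)
    set w : ℝ := e / (32 * 45 ^ n * N ^ n) with hw
    have hwpos : 0 < w := by positivity
    have hev := (ENNReal.tendsto_nhds_zero.1 hvmo) (ENNReal.ofReal (w / 2)) (by simpa using hwpos)
    obtain ⟨δ0, hδ0, hδ0pos⟩ := (hev.and self_mem_nhdsWithin).exists
    have hδ0pos : 0 < δ0 := hδ0pos
    have hosc2 : ∀ c r, 0 < r → 2 * r ≤ δ0 →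
        oscN (fun t => |f t|) (Metric.closedBall c r) ≤ w := by
      intro c r hr hrδ
      have h1 := osc_abs hr (int_cb hf c r)
      have h2 : oscN f (Metric.closedBall c r) ≤ w / 2 := by
        rw [← ENNReal.ofReal_le_ofReal_iff (by positivity)]
        refine le_trans ?_ hδ0
        rw [cb_eq c hr]
        exact le_iSup_of_le _ (le_iSup_of_le _ (le_iSup_of_le (by positivity)
          (le_iSup_of_le hrδ le_rfl)))
      linarith
    filter_upwards [Ioc_mem_nhdsGT (show 0 < δ0 / (3 * N) by positivity)] with δ hδ
    refine le_trans ?_ hee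
    refine iSup_le fun a => iSup_le fun l => iSup_le fun hl => iSup_le fun hlδ => ?_
    apply ENNReal.ofReal_le_ofReal
    rw [cube_eq a hl]
    have hl2 : 0 < l / 2 := by positivity
    have hlN : l * (3 * N) ≤ δ0 := by
      rw [← le_div_iff₀ (by positivity)]; exact hlδ.trans hδ.2
    have := (concl hf (by positivity) hl2 _ (hpt _ _ hl2)
      (core hn hf (show 0 < e / 4 by positivity) hN1 hwpos hl2 hN
        (fun c r hr hr2 => hosc2 c r hr (by linarith)) (fun i => a i + l / 2))).2.2
    refine this.trans (le_of_eq ?_)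
    rw [hw]
    field_simp
    ring
end

section
/- Let log⁻|x| = max{0, −log|x|} denote the negative part of the logarithm, and let p, q > 0 with p + q ≤ 1. Then the function f(x,y) = (log⁻|x|)^p (log⁻|y|)^q belongs to BMO(ℝ²), i.e. ‖f‖_{BMO(ℝ²)} < ∞. -/
open MeasureTheory Set Filter
open scoped ENNReal Topology

/-- Mean oscillation of `f : ℝ × ℝ → ℝ` over `E ⊆ ℝ²`. -/
noncomputable def osc2 (f : ℝ × ℝ → ℝ) (E : Set (ℝ × ℝ)) : ℝ :=
  ⨍ p in E, |f p - ⨍ q in E, f q|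

/-- BMO(ℝ²) seminorm: supremum over closed axis-parallel squares of positive side length. -/
noncomputable def bmo2 (f : ℝ × ℝ → ℝ) : ℝ≥0∞ :=
  ⨆ (a : ℝ) (b : ℝ) (l : ℝ) (_ : 0 < l),
    ENNReal.ofReal (osc2 f (Icc a (a + l) ×ˢ Icc b (b + l)))

/-- The negative part of the logarithm: `log⁻|x| = max {0, −log|x|}`. -/
noncomputable def logMinus (x : ℝ) : ℝ := max 0 (-Real.log |x|)

lemma lm_nonneg (x : ℝ) : 0 ≤ logMinus x := le_max_left _ _

lemma lm_meas : Measurable logMinus := by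
  unfold logMinus; fun_prop

lemma lm_rpow_meas (p : ℝ) : Measurable (fun x => logMinus x ^ p) := lm_meas.pow_const p

lemma log_intOn (a b : ℝ) : IntegrableOn Real.log (Icc a b) := by
  rcases le_or_gt a b with h | h
  · rw [integrableOn_Icc_iff_integrableOn_Ioc, ← intervalIntegrable_iff_integrableOn_Ioc_of_le h]
    exact intervalIntegral.intervalIntegrable_log'
  · simp [Icc_eq_empty_of_lt h]

lemma rpow_le_one_add {t p : ℝ} (ht : 0 ≤ t) (hp : 0 < p) (hp1 : p ≤ 1) : t ^ p ≤ 1 + t := by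
  rcases le_total t 1 with h | h
  · have := Real.rpow_le_one ht h hp.le
    linarith
  · have := Real.rpow_le_rpow_of_exponent_le h hp1
    rw [Real.rpow_one] at this
    linarith

lemma lm_integrable {p : ℝ} (hp : 0 < p) (hp1 : p ≤ 1) : Integrable (fun x => logMinus x ^ p) := by
  have h1 : IntegrableOn (fun x => logMinus x ^ p) (Icc (-1) 1) := by
    have h2 : IntegrableOn (fun x => 1 + |Real.log x|) (Icc (-1) 1) :=
      (integrableOn_const (by simp)).add (log_intOn _ _).abs
    refine Integrable.mono' h2 (lm_rpow_meas p).aestronglyMeasurable ?_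
    refine Eventually.of_forall fun x => ?_
    rw [Real.norm_of_nonneg (Real.rpow_nonneg (lm_nonneg x) p)]
    refine (rpow_le_one_add (lm_nonneg x) hp hp1).trans ?_
    have : logMinus x ≤ |Real.log x| := by
      unfold logMinus
      rw [Real.log_abs]
      exact max_le (abs_nonneg _) (neg_le_abs _)
    linarith
  refine h1.integrable_of_forall_notMem_eq_zero fun x hx => ?_
  have hx' : 1 ≤ |x| := by
    by_contra h
    push Not at h
    exact hx ⟨(abs_lt.1 h).1.le, (abs_lt.1 h).2.le⟩
  have : logMinus x = 0 := by
    unfold logMinus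
    exact max_eq_left (by simpa using Real.log_nonneg hx')
  simp only [this]
  exact Real.zero_rpow hp.ne'

lemma lm_anti {y N : ℝ} (hy : 0 < |y|) (hN : |y| ≤ N) : logMinus N ≤ logMinus y := by
  unfold logMinus
  rw [abs_of_pos (hy.trans_le hN)]
  exact max_le_max le_rfl (neg_le_neg (Real.log_le_log hy hN))

lemma lm_diff {y N : ℝ} (hy : 0 < |y|) (hN : |y| ≤ N) :
    logMinus y - logMinus N ≤ Real.log N - Real.log |y| := by
  unfold logMinus
  rw [abs_of_pos (hy.trans_le hN)]
  have := Real.log_le_log hy hN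
  rcases le_total 0 (-Real.log |y|) with h | h
  · rw [max_eq_right h]
    have := le_max_right 0 (-Real.log N)
    linarith
  · rw [max_eq_left h]
    have := le_max_left 0 (-Real.log N)
    linarith

lemma pow_diff {t m q L : ℝ} (hm : 0 ≤ m) (hmt : m ≤ t) (ht : 0 < t) (hq : 0 < q) (hq1 : q ≤ 1)
    (hL : 0 ≤ L) : L ^ (1 - q) * (t ^ q - m ^ q) ≤ (1 + L / t) * (t - m) := by
  have h1 : t ^ q - m ^ q ≤ (t - m) / t ^ (1 - q) := by
    rw [le_div_iff₀ (by positivity), sub_mul, ← Real.rpow_add ht]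
    have : m ≤ m ^ q * t ^ (1 - q) := by
      rcases hm.eq_or_lt with h | h
      · rw [← h]; positivity
      · calc m = m ^ q * m ^ (1 - q) := by rw [← Real.rpow_add h]; simp
          _ ≤ _ := by gcongr
    simp only [add_sub_cancel, Real.rpow_one]
    linarith
  calc L ^ (1 - q) * (t ^ q - m ^ q) ≤ L ^ (1 - q) * ((t - m) / t ^ (1 - q)) := by gcongr
    _ = (L / t) ^ (1 - q) * (t - m) := by rw [Real.div_rpow hL ht.le]; ring
    _ ≤ _ := by
      have : 0 ≤ t - m := by linarith
      gcongr
      rcases hq1.eq_or_lt with h | h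
      · subst h; simp only [sub_self, Real.rpow_zero]; linarith [div_nonneg hL ht.le]
      · exact rpow_le_one_add (by positivity) (by linarith) (by linarith)

lemma rpow_sub_le {t m q : ℝ} (hm : 0 ≤ m) (hmt : m ≤ t) (hq : 0 < q) (hq1 : q ≤ 1) :
    t ^ q - m ^ q ≤ (t - m) ^ q := by
  have := Real.rpow_add_le_add_rpow hm (sub_nonneg.2 hmt) hq.le hq1
  rw [add_sub_cancel] at this
  linarith

lemma log2_lb : (1:ℝ) / 2 ≤ Real.log 2 := by have := Real.log_two_gt_d9; linarith
lemma log2_ub : Real.log 2 ≤ 1 := by have := Real.log_two_lt_d9; linarith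

lemma near_pt {q l N y : ℝ} (hq : 0 < q) (hq1 : q ≤ 1) (hl : 0 < l) (hl1 : l ≤ 1 / 8)
    (hN : N ≤ 2 * l) (hy : 0 < |y|) (hyN : |y| ≤ N) :
    (1 - Real.log l) ^ (1 - q) * |logMinus y ^ q - logMinus N ^ q|
      ≤ 6 * (Real.log N - Real.log |y|) := by
  have hN0 := hy.trans_le hyN
  have hmt := lm_anti hy hyN
  have hd := lm_diff hy hyN
  have hm : logMinus N = - Real.log N := by
    unfold logMinus
    rw [abs_of_pos hN0]
    exact max_eq_right (by simpa using Real.log_nonpos hN0.le (by linarith))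
  have hlogN : Real.log N ≤ Real.log 2 + Real.log l := by
    rw [← Real.log_mul (by norm_num) hl.ne']; exact Real.log_le_log hN0 hN
  have hlogN2 : Real.log N ≤ - Real.log 2 := by
    rw [← Real.log_inv]; exact Real.log_le_log hN0 (by linarith)
  have := log2_lb
  have := log2_ub
  have ht : 0 < logMinus y := by linarith
  have hll : Real.log l ≤ 0 := Real.log_nonpos hl.le (by linarith)
  rw [abs_of_nonneg (sub_nonneg.2 (Real.rpow_le_rpow (lm_nonneg N) hmt hq.le))]
  refine (pow_diff (lm_nonneg N) hmt ht hq hq1 (by linarith)).trans ?_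
  have h3 : (1 - Real.log l) / logMinus y ≤ 5 := by
    rw [div_le_iff₀ ht]; linarith
  have : 0 ≤ logMinus y - logMinus N := by linarith
  nlinarith

lemma far_pt {q l N y : ℝ} (hq : 0 < q) (hq1 : q ≤ 1) (hl : 0 < l) (hl1 : l ≤ 1 / 8)
    (hN : 2 * l ≤ N) (hy : N - l ≤ |y|) (hyN : |y| ≤ N) :
    (1 - Real.log l) ^ (1 - q) * |logMinus y ^ q - logMinus N ^ q|
      ≤ 10 + 3 * (1 + 1 / q) := by
  have hy0 : 0 < |y| := by linarith
  have hN0 := hy0.trans_le hyN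
  have hmt := lm_anti hy0 hyN
  have hd := lm_diff hy0 hyN
  have hll : Real.log l ≤ 0 := Real.log_nonpos hl.le (by linarith)
  have hq' : 0 < 1 / q := by positivity
  have hlog : Real.log N - Real.log |y| ≤ l / (N - l) := by
    rw [← Real.log_div hN0.ne' hy0.ne']
    refine (Real.log_le_sub_one_of_pos (by positivity)).trans ?_
    have h0 : 0 < N - l := by linarith
    calc N / |y| - 1 ≤ N / (N - l) - 1 := by gcongr
      _ = l / (N - l) := by field_simp; ring
  rw [abs_of_nonneg (sub_nonneg.2 (Real.rpow_le_rpow (lm_nonneg N) hmt hq.le))]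
  rcases le_total N (1 / 2) with h | h
  · have hm : logMinus N = - Real.log N := by
      unfold logMinus
      rw [abs_of_pos hN0]
      exact max_eq_right (by simpa using Real.log_nonpos hN0.le (by linarith))
    have hlogN2 : Real.log N ≤ - Real.log 2 := by
      rw [← Real.log_inv]; exact Real.log_le_log hN0 (by linarith)
    have := log2_lb
    have ht : 0 < logMinus y := by linarith
    refine (pow_diff (lm_nonneg N) hmt ht hq hq1 (by linarith)).trans ?_
    -- with `s = N / l`
    have hs : Real.log N - Real.log l ≤ N / l := by
      rw [← Real.log_div hN0.ne' hl.ne']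
      exact (Real.log_le_sub_one_of_pos (by positivity)).trans (by linarith)
    have hs2 : 2 ≤ N / l := by rw [le_div_iff₀ hl]; linarith
    have hdd : logMinus y - logMinus N ≤ 2 / (N / l) := by
      refine (hd.trans hlog).trans ?_
      rw [div_div_eq_mul_div]
      rw [div_le_div_iff₀ (by linarith) hN0]
      nlinarith
    have h3 : (1 - Real.log l) / logMinus y ≤ 3 + 2 * (N / l) := by
      rw [div_le_iff₀ ht]
      have : N / l ≤ 2 * (N / l) * logMinus y := by nlinarith
      nlinarith
    have h4 : 0 ≤ logMinus y - logMinus N := by linarith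
    have h5 : (1 + (1 - Real.log l) / logMinus y) * (logMinus y - logMinus N)
        ≤ (4 + 2 * (N / l)) * (2 / (N / l)) := by
      apply mul_le_mul _ hdd h4 (by positivity)
      linarith
    refine h5.trans ?_
    have : (4 + 2 * (N / l)) * (2 / (N / l)) = 8 / (N / l) + 4 := by
      field_simp
      ring
    rw [this]
    have : 8 / (N / l) ≤ 4 := by rw [div_le_iff₀ (by positivity)]; linarith
    linarith
  · have h1 : logMinus y - logMinus N ≤ 3 * l := by
      refine (hd.trans hlog).trans ?_
      rw [div_le_iff₀ (by linarith)]
      nlinarith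
    have h2 : logMinus y ^ q - logMinus N ^ q ≤ 3 * l ^ q := by
      refine (rpow_sub_le (lm_nonneg N) hmt hq hq1).trans ?_
      refine (Real.rpow_le_rpow (by linarith) h1 hq.le).trans ?_
      rw [Real.mul_rpow (by norm_num) hl.le]
      gcongr
      exact (Real.rpow_le_rpow_of_exponent_le (by norm_num) hq1).trans (by simp)
    have h3 : (1 - Real.log l) ^ (1 - q) ≤ 1 - Real.log l := by
      exact (Real.rpow_le_rpow_of_exponent_le (by linarith) (by linarith : 1 - q ≤ 1)).trans (by simp)
    have h4 : -Real.log l * l ^ q ≤ 1 / q := by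
      have := Real.log_le_rpow_div (x := l⁻¹) (by positivity) hq
      rw [Real.log_inv, Real.inv_rpow hl.le] at this
      calc -Real.log l * l ^ q ≤ (l ^ q)⁻¹ / q * l ^ q := by gcongr
        _ = 1 / q := by field_simp
    have h5 : l ^ q ≤ 1 := Real.rpow_le_one hl.le (by linarith) hq.le
    have h6 : 0 ≤ l ^ q := by positivity
    have h7 := mul_le_mul h3 h2 (sub_nonneg.2 (Real.rpow_le_rpow (lm_nonneg N) hmt hq.le)) (by linarith)
    nlinarith

lemma near_int {N : ℝ} (hN : 0 < N) :
    ∫ y in Icc (-N) N, (Real.log N - Real.log |y|) = 2 * N := by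
  rw [integral_Icc_eq_integral_Ioc, ← intervalIntegral.integral_of_le (by linarith)]
  simp only [Real.log_abs]
  rw [intervalIntegral.integral_sub (by simp) intervalIntegral.intervalIntegrable_log', integral_log]
  simp
  ring

/-- one-dimensional estimate -/
lemma one_dim {q : ℝ} (hq : 0 < q) (hq1 : q ≤ 1) : ∃ C : ℝ, 0 ≤ C ∧ ∀ a l : ℝ, 0 < l → l ≤ 1 / 8 →
    ∃ c : ℝ, 0 ≤ c ∧ c ≤ (1 - Real.log l) ^ q ∧
      (1 - Real.log l) ^ (1 - q) * ∫ y in Icc a (a + l), |logMinus y ^ q - c| ≤ C * l := by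
  refine ⟨24 + (10 + 3 * (1 + 1 / q)), by positivity, fun a l hl hl1 => ?_⟩
  set N := max |a| |a + l| with hNdef
  have hlN : l / 2 ≤ N := by
    have h1 : |a| ≤ N := le_max_left _ _
    have h2 : |a + l| ≤ N := le_max_right _ _
    have := neg_abs_le a
    have := le_abs_self (a + l)
    linarith
  have hN0 : 0 < N := by linarith
  have hll : Real.log l ≤ 0 := Real.log_nonpos hl.le (by linarith)
  have hyN : ∀ y ∈ Icc a (a + l), |y| ≤ N := fun y hy => abs_le_max_abs_abs hy.1 hy.2
  refine ⟨logMinus N ^ q, Real.rpow_nonneg (lm_nonneg _) _, ?_, ?_⟩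
  · refine Real.rpow_le_rpow (lm_nonneg _) ?_ hq.le
    unfold logMinus
    refine max_le (by linarith) ?_
    rw [abs_of_pos hN0]
    have := Real.log_le_log (by positivity) hlN
    rw [Real.log_div hl.ne' (by norm_num)] at this
    have := log2_ub
    linarith
  have hint : IntegrableOn (fun y => (1 - Real.log l) ^ (1 - q) * |logMinus y ^ q - logMinus N ^ q|)
      (Icc a (a + l)) :=
    (((lm_integrable hq hq1).integrableOn).sub (integrableOn_const (by simp))).abs.const_mul _
  rw [← integral_const_mul]
  have hq' : 0 < 1 / q := by positivity
  rcases le_total N (2 * l) with h | h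
  · have hi2 : IntegrableOn (fun y => 6 * (Real.log N - Real.log |y|)) (Icc (-N) N) := by
      simp only [Real.log_abs]
      exact ((integrableOn_const (by simp)).sub (log_intOn _ _)).const_mul _
    have hsub : Icc a (a + l) ⊆ Icc (-N) N := fun y hy => abs_le.1 (hyN y hy)
    have hne : ∀ᵐ y : ℝ, y ≠ 0 := by simp [ae_iff]
    calc _ ≤ ∫ y in Icc a (a + l), 6 * (Real.log N - Real.log |y|) := by
          refine setIntegral_mono_on_ae hint (hi2.mono_set hsub) measurableSet_Icc ?_
          filter_upwards [hne] with y hy hyI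
          exact near_pt hq hq1 hl hl1 h (abs_pos.2 hy) (hyN y hyI)
      _ ≤ ∫ y in Icc (-N) N, 6 * (Real.log N - Real.log |y|) := by
          refine setIntegral_mono_set hi2 ?_ hsub.eventuallyLE
          rw [EventuallyLE, ae_restrict_iff' measurableSet_Icc]
          filter_upwards [hne] with y hy hyI
          have := Real.log_le_log (abs_pos.2 hy) (abs_le.2 hyI)
          simp only [Pi.zero_apply]
          linarith
      _ = 6 * (2 * N) := by rw [integral_const_mul, near_int hN0]
      _ ≤ _ := by nlinarith
  · calc _ ≤ ∫ y in Icc a (a + l), (10 + 3 * (1 + 1 / q)) := by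
          refine setIntegral_mono_on hint (integrableOn_const (by simp)) measurableSet_Icc ?_
          intro y hyI
          refine far_pt hq hq1 hl hl1 h ?_ (hyN y hyI)
          have h1 := neg_abs_le y
          have h2 := le_abs_self y
          have h3 : N ≤ |y| + l := by
            refine max_le (abs_le.2 ⟨?_, ?_⟩) (abs_le.2 ⟨?_, ?_⟩) <;> linarith [hyI.1, hyI.2]
          linarith
      _ = (10 + 3 * (1 + 1 / q)) * l := by
          simp [hl.le]; ring
      _ ≤ _ := by nlinarith

lemma osc_le {f : ℝ × ℝ → ℝ} (hf : Integrable f) (c a b l : ℝ) (hl : 0 < l) :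
    osc2 f (Icc a (a + l) ×ˢ Icc b (b + l)) ≤
      2 * ((l * l)⁻¹ * ∫ z in Icc a (a + l) ×ˢ Icc b (b + l), |f z - c|) := by
  set Q := Icc a (a + l) ×ˢ Icc b (b + l) with hQ
  have hv : volume.real Q = l * l := by
    rw [hQ, Measure.volume_eq_prod, measureReal_prod_prod]; simp [hl.le]
  have hfin : volume Q ≠ ⊤ := by
    intro h
    have : volume.real Q = 0 := by simp [Measure.real, h]
    rw [hv] at this
    nlinarith
  have hc : ∀ c : ℝ, IntegrableOn (fun _ : ℝ × ℝ => c) Q := fun c => integrableOn_const hfin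
  have hl2 : 0 < l * l := by positivity
  set A := ⨍ q in Q, f q with hA
  have hA' : |c - A| ≤ (l * l)⁻¹ * ∫ z in Q, |f z - c| := by
    have : A - c = (l * l)⁻¹ * ∫ z in Q, (f z - c) := by
      rw [integral_sub hf.integrableOn (hc c), hA, setAverage_eq, setIntegral_const, hv]
      simp only [smul_eq_mul]
      field_simp
    rw [abs_sub_comm, this, abs_mul, abs_of_pos (inv_pos.2 hl2)]
    gcongr
    exact abs_integral_le_integral_abs
  unfold osc2
  rw [← hA, setAverage_eq, hv, smul_eq_mul]
  have : ∫ z in Q, |f z - A| ≤ ∫ z in Q, (|f z - c| + |c - A|) := by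
    refine integral_mono (hf.integrableOn.sub (hc A)).abs
      ((hf.integrableOn.sub (hc c)).abs.add (hc _)) fun z => abs_sub_le _ _ _
  have hfc : IntegrableOn (fun z => |f z - c|) Q := (hf.integrableOn.sub (hc c)).abs
  rw [integral_add hfc (hc _), setIntegral_const, hv, smul_eq_mul] at this
  calc _ ≤ (l * l)⁻¹ * ((∫ z in Q, |f z - c|) + l * l * |c - A|) := by gcongr
    _ = (l * l)⁻¹ * (∫ z in Q, |f z - c|) + |c - A| := by field_simp
    _ ≤ _ := by linarith

lemma prod_int {u v : ℝ → ℝ} (s t : Set ℝ) :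
    ∫ z in s ×ˢ t, u z.1 * v z.2 = (∫ x in s, u x) * ∫ y in t, v y := by
  rw [Measure.volume_eq_prod]
  exact setIntegral_prod_mul u v s t

lemma small_case {p q : ℝ} (hp : 0 < p) (hq : 0 < q) (hpq : p + q ≤ 1) : ∃ C : ℝ, 0 ≤ C ∧
    ∀ a b l : ℝ, 0 < l → l ≤ 1 / 8 → ∃ c : ℝ,
      ∫ z in Icc a (a + l) ×ˢ Icc b (b + l), |logMinus z.1 ^ p * logMinus z.2 ^ q - c|
        ≤ C * (l * l) := by
  have hp1 : p ≤ 1 := by linarith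
  have hq1 : q ≤ 1 := by linarith
  obtain ⟨C, hC, HC⟩ := one_dim hp hp1
  obtain ⟨D, hD, HD⟩ := one_dim hq hq1
  refine ⟨C * D + C + D, by positivity, fun a b l hl hl1 => ?_⟩
  obtain ⟨c, hc0, hc, Hc⟩ := HC a l hl hl1
  obtain ⟨d, hd0, hd, Hd⟩ := HD b l hl hl1
  refine ⟨c * d, ?_⟩
  set I := Icc a (a + l) with hI
  set J := Icc b (b + l) with hJ
  have hll : Real.log l ≤ 0 := Real.log_nonpos hl.le (by linarith)
  set L := 1 - Real.log l with hL
  have hL1 : 1 ≤ L := by linarith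
  set X := ∫ y in I, |logMinus y ^ p - c| with hX
  set Y := ∫ y in J, |logMinus y ^ q - d| with hY
  have hX0 : 0 ≤ X := integral_nonneg fun _ => abs_nonneg _
  have hY0 : 0 ≤ Y := integral_nonneg fun _ => abs_nonneg _
  have iX : IntegrableOn (fun y => |logMinus y ^ p - c|) I :=
    (((lm_integrable hp hp1).integrableOn).sub (integrableOn_const (by simp [hI]))).abs
  have iY : IntegrableOn (fun y => |logMinus y ^ q - d|) J :=
    (((lm_integrable hq hq1).integrableOn).sub (integrableOn_const (by simp [hJ]))).abs
  have ic : IntegrableOn (fun _ : ℝ => c) I := integrableOn_const (by simp [hI])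
  have id' : IntegrableOn (fun _ : ℝ => d) J := integrableOn_const (by simp [hJ])
  have hXC : X ≤ C * l := by
    have : 1 ≤ L ^ (1 - p) := Real.one_le_rpow hL1 (by linarith)
    nlinarith
  have hYD : Y ≤ D * l := by
    have : 1 ≤ L ^ (1 - q) := Real.one_le_rpow hL1 (by linarith)
    nlinarith
  have hcY : c * Y ≤ D * l := by
    have : c ≤ L ^ (1 - q) := hc.trans (Real.rpow_le_rpow_of_exponent_le hL1 (by linarith))
    nlinarith
  have hdX : X * d ≤ C * l := by
    have : d ≤ L ^ (1 - p) := hd.trans (Real.rpow_le_rpow_of_exponent_le hL1 (by linarith))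
    nlinarith
  have mk : ∀ {u v : ℝ → ℝ}, IntegrableOn u I → IntegrableOn v J →
      IntegrableOn (fun z : ℝ × ℝ => u z.1 * v z.2) (I ×ˢ J) := by
    intro u v hu hv
    unfold IntegrableOn
    rw [Measure.volume_eq_prod, ← Measure.prod_restrict]
    exact Integrable.mul_prod hu hv
  have key : ∫ z in I ×ˢ J, |logMinus z.1 ^ p * logMinus z.2 ^ q - c * d| ≤
      ∫ z in I ×ˢ J, (|logMinus z.1 ^ p - c| * |logMinus z.2 ^ q - d| + c * |logMinus z.2 ^ q - d|
        + |logMinus z.1 ^ p - c| * d) := by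
    refine integral_mono_of_nonneg (Eventually.of_forall fun _ => abs_nonneg _)
      (((mk iX iY).add (mk ic iY)).add (mk iX id')) (Eventually.of_forall fun z => ?_)
    have : logMinus z.1 ^ p * logMinus z.2 ^ q - c * d =
      (logMinus z.1 ^ p - c) * (logMinus z.2 ^ q - d) + c * (logMinus z.2 ^ q - d)
        + (logMinus z.1 ^ p - c) * d := by ring
    simp only [this]
    refine (abs_add_three _ _ _).trans ?_
    rw [abs_mul, abs_mul, abs_mul, abs_of_nonneg hc0, abs_of_nonneg hd0]
  refine key.trans ?_
  have hsum : IntegrableOn (fun z : ℝ × ℝ => |logMinus z.1 ^ p - c| * |logMinus z.2 ^ q - d|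
      + c * |logMinus z.2 ^ q - d|) (I ×ˢ J) := (mk iX iY).add (mk ic iY)
  rw [integral_add hsum (mk iX id'), integral_add (mk iX iY) (mk ic iY)]
  rw [prod_int (u := fun x => |logMinus x ^ p - c|) (v := fun y => |logMinus y ^ q - d|),
    prod_int (u := fun _ => c) (v := fun y => |logMinus y ^ q - d|),
    prod_int (u := fun x => |logMinus x ^ p - c|) (v := fun _ => d)]
  have e1 : ∫ _ in I, c = l * c := by simp [hI, hl.le]
  have e2 : ∫ _ in J, d = l * d := by simp [hJ, hl.le]
  rw [e1, e2]
  have : X * Y ≤ (C * l) * (D * l) := mul_le_mul hXC hYD hY0 (by positivity)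
  nlinarith

/-- for `p, q > 0` with `p + q ≤ 1`, the function
`f(x,y) = (log⁻|x|)^p (log⁻|y|)^q` belongs to `BMO(ℝ²)`. -/
theorem logp_logq_in_bmo (p q : ℝ) (hp : 0 < p) (hq : 0 < q) (hpq : p + q ≤ 1) :
    LocallyIntegrable (fun z : ℝ × ℝ => logMinus z.1 ^ p * logMinus z.2 ^ q) volume ∧
    bmo2 (fun z : ℝ × ℝ => logMinus z.1 ^ p * logMinus z.2 ^ q) ≠ ⊤ := by
  have hf : Integrable (fun z : ℝ × ℝ => logMinus z.1 ^ p * logMinus z.2 ^ q) := by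
    rw [Measure.volume_eq_prod]
    exact Integrable.mul_prod (lm_integrable hp (by linarith)) (lm_integrable hq (by linarith))
  refine ⟨hf.locallyIntegrable, ?_⟩
  obtain ⟨C, hC, HC⟩ := small_case hp hq hpq
  set K := ∫ z : ℝ × ℝ, |logMinus z.1 ^ p * logMinus z.2 ^ q - 0| with hK
  have hK0 : 0 ≤ K := integral_nonneg fun _ => abs_nonneg _
  refine ne_top_of_le_ne_top (b := ENNReal.ofReal (2 * C + 2 * (64 * K))) ENNReal.ofReal_ne_top ?_
  unfold bmo2
  refine iSup_le fun a => iSup_le fun b => iSup_le fun l => iSup_le fun hl => ?_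
  apply ENNReal.ofReal_le_ofReal
  rcases le_total l (1 / 8) with h | h
  · obtain ⟨c, hc⟩ := HC a b l hl h
    refine (osc_le hf c a b l hl).trans ?_
    have : (l * l)⁻¹ * ∫ z in Icc a (a + l) ×ˢ Icc b (b + l),
        |logMinus z.1 ^ p * logMinus z.2 ^ q - c| ≤ C := by
      rw [inv_mul_le_iff₀ (by positivity)]; linarith
    linarith
  · refine (osc_le hf 0 a b l hl).trans ?_
    have h1 : ∫ z in Icc a (a + l) ×ˢ Icc b (b + l),
        |logMinus z.1 ^ p * logMinus z.2 ^ q - 0| ≤ K := by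
      refine setIntegral_le_integral ?_ (Eventually.of_forall fun _ => abs_nonneg _)
      simpa using hf.abs
    have h2 : (l * l)⁻¹ ≤ 64 := by
      rw [inv_le_comm₀ (by positivity) (by norm_num)]; nlinarith
    have : (l * l)⁻¹ * ∫ z in Icc a (a + l) ×ˢ Icc b (b + l),
        |logMinus z.1 ^ p * logMinus z.2 ^ q - 0| ≤ 64 * K :=
      mul_le_mul h2 h1 (integral_nonneg fun _ => abs_nonneg _) (by norm_num)
    linarith
end

section
/- There exists a sequence of bounded measurable functions G_N : ℝ² → ℝ (N ≥ 1) and a constant C such that ‖G_N‖_{BMO(ℝ²)} ≤ C for all N, while ‖M_{e₁}(G_N)‖_{BMO(ℝ²)} → ∞ and ‖M_s(G_N)‖_{BMO(ℝ²)} → ∞ as N → ∞. In particular, neither the directional maximal operator M_{e₁} nor the strong maximal operator M_s is bounded on BMO(ℝ²), even when restricted to bounded functions. -/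
open MeasureTheory Set Filter
open scoped ENNReal Topology

/-- The directional maximal function in the direction `e₁`. -/
noncomputable def dirMax (f : ℝ × ℝ → ℝ) (x : ℝ × ℝ) : ℝ :=
  sSup {r : ℝ | ∃ a b : ℝ, a < b ∧ x.1 ∈ Icc a b ∧
    r = ⨍ t in Icc a b, |f (t, x.2)|}

/-- The strong maximal function (over axis-parallel rectangles). -/
noncomputable def strongMax (f : ℝ × ℝ → ℝ) (x : ℝ × ℝ) : ℝ :=
  sSup {r : ℝ | ∃ a b c d : ℝ, a < b ∧ c < d ∧ x ∈ Icc a b ×ˢ Icc c d ∧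
    r = ⨍ p in Icc a b ×ˢ Icc c d, |f p|}

namespace BmoAux

lemma vol_rect (a b c d : ℝ) (hab : a ≤ b) (hcd : c ≤ d) :
    (volume : Measure (ℝ × ℝ)).real (Icc a b ×ˢ Icc c d) = (b - a) * (d - c) := by
  rw [Measure.volume_eq_prod, measureReal_prod_prod, Real.volume_real_Icc_of_le hab,
    Real.volume_real_Icc_of_le hcd]

lemma vol_rect_ne_top (a b c d : ℝ) :
    (volume : Measure (ℝ × ℝ)) (Icc a b ×ˢ Icc c d) ≠ ⊤ :=
  (isCompact_Icc.prod isCompact_Icc).measure_lt_top.ne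

lemma integrableOn_bdd {α : Type*} [MeasurableSpace α] {μ : Measure α} {f : α → ℝ} {B : ℝ}
    {s : Set α} (hs : μ s ≠ ⊤) (hf : Measurable f) (hB : ∀ p, |f p| ≤ B) :
    IntegrableOn f s μ :=
  Measure.integrableOn_of_bounded hs hf.aestronglyMeasurable
    (Eventually.of_forall fun p => by simpa using hB p)

/-- Oscillation bounded by twice the average distance to any constant. -/
lemma osc_le {f : ℝ × ℝ → ℝ} {s : Set (ℝ × ℝ)} {c D : ℝ}
    (hs : volume s ≠ ⊤) (hpos : 0 < (volume : Measure (ℝ × ℝ)).real s)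
    (hf : IntegrableOn f s)
    (h : ∫ p in s, |f p - c| ≤ D * (volume : Measure (ℝ × ℝ)).real s) :
    osc2 f s ≤ 2 * D := by
  unfold osc2
  set m := ⨍ q in s, f q with hm
  set v := (volume : Measure (ℝ × ℝ)).real s with hv
  have hc : ∀ e : ℝ, IntegrableOn (fun _ : ℝ × ℝ => e) s := fun e => integrableOn_const hs
  have i1 : ∀ e : ℝ, IntegrableOn (fun p => |f p - e|) s := fun e => (hf.sub (hc e)).abs
  have hmv : v * m = ∫ q in s, f q := by
    rw [hm, setAverage_eq, smul_eq_mul, ← mul_assoc, mul_inv_cancel₀ hpos.ne', one_mul]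
  have h2 : v * |m - c| ≤ D * v := by
    have : v * (m - c) = ∫ p in s, (f p - c) := by
      rw [integral_sub hf (hc c), setIntegral_const, smul_eq_mul, ← hmv]; ring
    rw [← abs_of_pos hpos, ← abs_mul, this, abs_of_pos hpos]
    exact (abs_integral_le_integral_abs).trans h
  have h3 : ∫ p in s, |f p - m| ≤ ∫ p in s, (|f p - c| + |m - c|) := by
    apply integral_mono (i1 m) ((i1 c).add (hc _))
    intro p
    have := abs_sub_le (f p) c m
    rw [abs_sub_comm c m] at this
    exact this
  rw [integral_add (i1 c) (hc _), setIntegral_const, smul_eq_mul] at h3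
  rw [setAverage_eq, smul_eq_mul, inv_mul_le_iff₀ hpos]
  linarith

/-- Lower bound for the `BMO` seminorm from two separated parts of `[0,4]²`. -/
lemma bmo_lower {F : ℝ × ℝ → ℝ} {A B K : ℝ} (hF : Measurable F) (hK : ∀ p, |F p| ≤ K)
    (hA : ∀ p ∈ Icc (0:ℝ) 4 ×ˢ Icc (0:ℝ) 1, A ≤ F p)
    (hB : ∀ p ∈ Icc (0:ℝ) 4 ×ˢ Icc (3:ℝ) 4, F p ≤ B) :
    ENNReal.ofReal ((A - B) / 4) ≤ bmo2 F := by
  have key : (A - B) / 4 ≤ osc2 F (Icc (0:ℝ) (0+4) ×ˢ Icc (0:ℝ) (0+4)) := by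
    unfold osc2
    rw [zero_add]
    set m := ⨍ q in Icc (0:ℝ) 4 ×ˢ Icc (0:ℝ) 4, F q
    have i1 : ∀ a b c d : ℝ, IntegrableOn (fun p => |F p - m|) (Icc a b ×ˢ Icc c d) :=
      fun a b c d => ((integrableOn_bdd (vol_rect_ne_top a b c d) hF hK).sub
        (integrableOn_const (vol_rect_ne_top a b c d))).abs
    have ic : ∀ a b c d e : ℝ, IntegrableOn (fun _ : ℝ × ℝ => e) (Icc a b ×ˢ Icc c d) :=
      fun a b c d e => integrableOn_const (vol_rect_ne_top a b c d)
    have h1 : 4 * (A - m) ≤ ∫ p in Icc (0:ℝ) 4 ×ˢ Icc (0:ℝ) 1, |F p - m| := by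
      have := setIntegral_mono_on (ic 0 4 0 1 (A - m)) (i1 0 4 0 1)
        (measurableSet_Icc.prod measurableSet_Icc)
        (fun p hp => (sub_le_sub_right (hA p hp) m).trans (le_abs_self _))
      rw [setIntegral_const, vol_rect _ _ _ _ (by norm_num) (by norm_num), smul_eq_mul] at this
      linarith
    have h2 : 4 * (m - B) ≤ ∫ p in Icc (0:ℝ) 4 ×ˢ Icc (3:ℝ) 4, |F p - m| := by
      have := setIntegral_mono_on (ic 0 4 3 4 (m - B)) (i1 0 4 3 4)
        (measurableSet_Icc.prod measurableSet_Icc)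
        (fun p hp => (sub_le_sub_left (hB p hp) m).trans
          ((le_abs_self _).trans_eq (abs_sub_comm _ _)))
      rw [setIntegral_const, vol_rect _ _ _ _ (by norm_num) (by norm_num), smul_eq_mul] at this
      linarith
    have h3 : ∫ p in (Icc (0:ℝ) 4 ×ˢ Icc (0:ℝ) 1) ∪ (Icc (0:ℝ) 4 ×ˢ Icc (3:ℝ) 4), |F p - m|
        ≤ ∫ p in Icc (0:ℝ) 4 ×ˢ Icc (0:ℝ) 4, |F p - m| := by
      apply setIntegral_mono_set (i1 0 4 0 4) (Eventually.of_forall fun p => abs_nonneg _)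
      apply LE.le.eventuallyLE
      rintro ⟨x, y⟩ h
      simp only [mem_union, mem_prod, mem_Icc] at h ⊢
      rcases h with h | h <;> refine ⟨h.1, ?_, ?_⟩ <;> linarith [h.2.1, h.2.2]
    rw [setIntegral_union _ (measurableSet_Icc.prod measurableSet_Icc) (i1 _ _ _ _)
      (i1 _ _ _ _)] at h3
    · rw [setAverage_eq, vol_rect _ _ _ _ (by norm_num) (by norm_num), smul_eq_mul]
      linarith
    · rw [Set.disjoint_left]
      rintro ⟨x, y⟩ h h'
      simp only [mem_prod, mem_Icc] at h h'
      linarith [h.2.2, h'.2.1]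
  refine (ENNReal.ofReal_le_ofReal key).trans ?_
  unfold bmo2
  exact le_iSup_of_le 0 (le_iSup_of_le 0 (le_iSup_of_le 4 (le_iSup_of_le (by norm_num) le_rfl)))

lemma avg_le {α : Type*} [MeasurableSpace α] {μ : Measure α} {f : α → ℝ} {B : ℝ} {s : Set α}
    (hs : μ s ≠ ⊤) (hB0 : 0 ≤ B) (hms : MeasurableSet s) (hf : IntegrableOn f s μ)
    (hB : ∀ p ∈ s, f p ≤ B) : ⨍ p in s, f p ∂μ ≤ B := by
  rw [setAverage_eq, smul_eq_mul]
  have := setIntegral_mono_on hf (integrableOn_const (C := B) hs) hms hB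
  rw [setIntegral_const, smul_eq_mul] at this
  rcases (measureReal_nonneg (μ := μ) (s := s)).eq_or_lt with h | h
  · rw [← h]; simpa
  · rw [inv_mul_le_iff₀ h]; exact this

lemma avg_nonneg {α : Type*} [MeasurableSpace α] {μ : Measure α} {f : α → ℝ} {s : Set α}
    (hf : ∀ p, 0 ≤ f p) : 0 ≤ ⨍ p in s, f p ∂μ := by
  rw [setAverage_eq, smul_eq_mul]
  exact mul_nonneg (inv_nonneg.2 measureReal_nonneg) (integral_nonneg hf)

section maxfun
variable {f : ℝ × ℝ → ℝ} {B : ℝ}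

lemma slice_int (hf : Measurable f) (hB : ∀ p, |f p| ≤ B) (y a b : ℝ) :
    IntegrableOn (fun t => |f (t, y)|) (Icc a b) :=
  integrableOn_bdd (B := B) (by simp) (by fun_prop) (fun p => by simpa using hB (p, y))

lemma rect_int (hf : Measurable f) (hB : ∀ p, |f p| ≤ B) (a b c d : ℝ) :
    IntegrableOn (fun p => |f p|) (Icc a b ×ˢ Icc c d) :=
  integrableOn_bdd (B := B) (vol_rect_ne_top _ _ _ _) (by fun_prop) (fun p => by simpa using hB p)

lemma B_nonneg (hB : ∀ p, |f p| ≤ B) : 0 ≤ B := (abs_nonneg _).trans (hB 0)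

lemma dir_bdd (hf : Measurable f) (hB : ∀ p, |f p| ≤ B) (x : ℝ × ℝ) :
    ∀ r ∈ {r : ℝ | ∃ a b : ℝ, a < b ∧ x.1 ∈ Icc a b ∧ r = ⨍ t in Icc a b, |f (t, x.2)|},
      r ≤ B := by
  rintro r ⟨a, b, hab, hx, rfl⟩
  exact avg_le (by simp) (B_nonneg hB) measurableSet_Icc (slice_int hf hB _ _ _)
    (fun p _ => hB _)

lemma str_bdd (hf : Measurable f) (hB : ∀ p, |f p| ≤ B) (x : ℝ × ℝ) :
    ∀ r ∈ {r : ℝ | ∃ a b c d : ℝ, a < b ∧ c < d ∧ x ∈ Icc a b ×ˢ Icc c d ∧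
    r = ⨍ p in Icc a b ×ˢ Icc c d, |f p|}, r ≤ B := by
  rintro r ⟨a, b, c, d, hab, hcd, hx, rfl⟩
  exact avg_le (vol_rect_ne_top _ _ _ _) (B_nonneg hB) (measurableSet_Icc.prod measurableSet_Icc)
    (rect_int hf hB _ _ _ _) (fun p _ => hB _)

lemma le_dir (hf : Measurable f) (hB : ∀ p, |f p| ≤ B) (x : ℝ × ℝ) {a b : ℝ} (hab : a < b)
    (hx : x.1 ∈ Icc a b) : ⨍ t in Icc a b, |f (t, x.2)| ≤ dirMax f x :=
  le_csSup ⟨B, dir_bdd hf hB x⟩ ⟨a, b, hab, hx, rfl⟩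

lemma le_str (hf : Measurable f) (hB : ∀ p, |f p| ≤ B) (x : ℝ × ℝ) {a b c d : ℝ} (hab : a < b)
    (hcd : c < d) (hx : x ∈ Icc a b ×ˢ Icc c d) :
    ⨍ p in Icc a b ×ˢ Icc c d, |f p| ≤ strongMax f x :=
  le_csSup ⟨B, str_bdd hf hB x⟩ ⟨a, b, c, d, hab, hcd, hx, rfl⟩

lemma dir_ne (x : ℝ × ℝ) :
    {r : ℝ | ∃ a b : ℝ, a < b ∧ x.1 ∈ Icc a b ∧ r = ⨍ t in Icc a b, |f (t, x.2)|}.Nonempty :=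
  ⟨_, x.1, x.1 + 1, by linarith, ⟨le_rfl, by linarith⟩, rfl⟩

lemma str_ne (x : ℝ × ℝ) :
    {r : ℝ | ∃ a b c d : ℝ, a < b ∧ c < d ∧ x ∈ Icc a b ×ˢ Icc c d ∧
    r = ⨍ p in Icc a b ×ˢ Icc c d, |f p|}.Nonempty :=
  ⟨_, x.1, x.1 + 1, x.2, x.2 + 1, by linarith, by linarith,
    ⟨⟨le_rfl, by linarith⟩, ⟨le_rfl, by linarith⟩⟩, rfl⟩

lemma dir_abs (hf : Measurable f) (hB : ∀ p, |f p| ≤ B) (x : ℝ × ℝ) : |dirMax f x| ≤ B := by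
  rw [abs_of_nonneg]
  · exact csSup_le (dir_ne x) (dir_bdd hf hB x)
  · refine Real.sSup_nonneg ?_
    rintro r ⟨a, b, hab, hx, rfl⟩
    exact avg_nonneg (fun p => abs_nonneg _)

lemma str_abs (hf : Measurable f) (hB : ∀ p, |f p| ≤ B) (x : ℝ × ℝ) : |strongMax f x| ≤ B := by
  rw [abs_of_nonneg]
  · exact csSup_le (str_ne x) (str_bdd hf hB x)
  · refine Real.sSup_nonneg ?_
    rintro r ⟨a, b, c, d, hab, hcd, hx, rfl⟩
    exact avg_nonneg (fun p => abs_nonneg _)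

/-- Slight enlargement keeps the average above the level. -/
lemma avg_enlarge {α : Type*} [MeasurableSpace α] {μ : Measure α} {g : α → ℝ} {s t : Set α}
    {l : ℝ} (hg : ∀ p, 0 ≤ g p) (hst : s ⊆ t) (hi : IntegrableOn g t μ)
    (hs : 0 < μ.real s) (ht : 0 < μ.real t) 
    (h : μ.real t * l < μ.real s * ⨍ p in s, g p ∂μ) : l < ⨍ p in t, g p ∂μ := by
  rw [setAverage_eq, smul_eq_mul, ← mul_assoc, mul_inv_cancel₀ hs.ne', one_mul] at h
  rw [setAverage_eq, smul_eq_mul, lt_inv_mul_iff₀ ht]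
  exact h.trans_le (setIntegral_mono_set hi (Eventually.of_forall hg) hst.eventuallyLE)

lemma str_meas (hf : Measurable f) (hB : ∀ p, |f p| ≤ B) : Measurable (strongMax f) := by
  apply measurable_of_Ioi
  intro l
  apply IsOpen.measurableSet
  rw [isOpen_iff_mem_nhds]
  intro x hx
  obtain ⟨r, ⟨a, b, c, d, hab, hcd, hxm, rfl⟩, hr⟩ := exists_lt_of_lt_csSup (str_ne x) hx
  have hcont : Tendsto (fun e : ℝ => ((b + e) - (a - e)) * ((d + e) - (c - e)) * l) (𝓝[>] 0)
      (𝓝 (((b + 0) - (a - 0)) * ((d + 0) - (c - 0)) * l)) := by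
    apply Tendsto.mono_left _ nhdsWithin_le_nhds
    apply Continuous.tendsto (f := fun e : ℝ => ((b + e) - (a - e)) * ((d + e) - (c - e)) * l)
    fun_prop
  have hpos : 0 < (b - a) * (d - c) := mul_pos (by linarith) (by linarith)
  have hlt : ((b + 0) - (a - 0)) * ((d + 0) - (c - 0)) * l <
      (b - a) * (d - c) * ⨍ p in Icc a b ×ˢ Icc c d, |f p| := by
    simp only [add_zero, sub_zero]
    exact mul_lt_mul_of_pos_left hr hpos
  obtain ⟨e, he, he0⟩ := ((hcont.eventually_lt_const hlt).and self_mem_nhdsWithin).exists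
  replace he0 : 0 < e := he0
  have hnb : Ioo (a - e) (b + e) ×ˢ Ioo (c - e) (d + e) ∈ 𝓝 x := by
    apply (isOpen_Ioo.prod isOpen_Ioo).mem_nhds
    obtain ⟨⟨h1, h2⟩, h3, h4⟩ := hxm
    exact ⟨⟨by linarith, by linarith⟩, by linarith, by linarith⟩
  filter_upwards [hnb] with z hz
  have h1 := le_str hf hB z (a := a - e) (b := b + e) (c := c - e) (d := d + e)
    (by linarith) (by linarith) ⟨Ioo_subset_Icc_self hz.1, Ioo_subset_Icc_self hz.2⟩
  refine lt_of_lt_of_le ?_ h1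
  apply avg_enlarge (s := Icc a b ×ˢ Icc c d) (fun p => abs_nonneg _)
  · exact prod_mono (Icc_subset_Icc (by linarith) (by linarith))
      (Icc_subset_Icc (by linarith) (by linarith))
  · exact rect_int hf hB _ _ _ _
  · rw [vol_rect _ _ _ _ hab.le hcd.le]; exact hpos
  · rw [vol_rect _ _ _ _ (by linarith) (by linarith)]; exact mul_pos (by linarith) (by linarith)
  · rw [vol_rect _ _ _ _ (by linarith) (by linarith), vol_rect _ _ _ _ hab.le hcd.le]
    exact he

lemma dir_meas (hf : Measurable f) (hB : ∀ p, |f p| ≤ B) : Measurable (dirMax f) := by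
  apply measurable_of_Ioi
  intro l
  have : dirMax f ⁻¹' Ioi l = ⋃ (a : ℚ) (b : ℚ) (_ : a < b),
      Icc (a:ℝ) b ×ˢ {y : ℝ | l < ⨍ t in Icc (a:ℝ) b, |f (t, y)|} := by
    ext x
    simp only [mem_preimage, mem_Ioi, mem_iUnion, mem_prod, mem_ofPred_eq, exists_prop]
    constructor
    · intro hx
      obtain ⟨r, ⟨a, b, hab, hxm, rfl⟩, hr⟩ := exists_lt_of_lt_csSup (dir_ne x) hx
      have hcont : Tendsto (fun e : ℝ => ((b + e) - (a - e)) * max l 0) (𝓝[>] 0)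
          (𝓝 (((b + 0) - (a - 0)) * max l 0)) := by
        apply Tendsto.mono_left _ nhdsWithin_le_nhds
        apply Continuous.tendsto (f := fun e : ℝ => ((b + e) - (a - e)) * max l 0)
        fun_prop
      rcases lt_or_ge l 0 with hl | hl
      · obtain ⟨a', ha1, ha2⟩ := exists_rat_btwn (show a - 1 < a by linarith)
        obtain ⟨b', hb1, hb2⟩ := exists_rat_btwn (show b < b + 1 by linarith)
        refine ⟨a', b', by exact_mod_cast (ha2.trans hab).trans hb1,
          ⟨by linarith [hxm.1], by linarith [hxm.2]⟩, hl.trans_le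
            (avg_nonneg fun p => abs_nonneg _)⟩
      rw [max_eq_left hl] at hcont
      have hlt : ((b + 0) - (a - 0)) * l < (b - a) * ⨍ t in Icc a b, |f (t, x.2)| := by
        simp only [add_zero, sub_zero]
        exact mul_lt_mul_of_pos_left hr (by linarith)
      obtain ⟨e, he, he0⟩ := ((hcont.eventually_lt_const hlt).and self_mem_nhdsWithin).exists
      replace he0 : 0 < e := he0
      obtain ⟨a', ha1, ha2⟩ := exists_rat_btwn (show a - e < a by linarith)
      obtain ⟨b', hb1, hb2⟩ := exists_rat_btwn (show b < b + e by linarith)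
      have hab' : (a' : ℝ) < b' := (ha2.trans hab).trans hb1
      refine ⟨a', b', by exact_mod_cast hab', ⟨by linarith [hxm.1], by linarith [hxm.2]⟩, ?_⟩
      apply avg_enlarge (s := Icc a b) (fun p => abs_nonneg _)
      · exact Icc_subset_Icc ha2.le hb1.le
      · exact slice_int hf hB _ _ _
      · rw [Real.volume_real_Icc_of_le hab.le]; linarith
      · rw [Real.volume_real_Icc_of_le hab'.le]; linarith
      · rw [Real.volume_real_Icc_of_le hab'.le, Real.volume_real_Icc_of_le hab.le]
        refine lt_of_le_of_lt ?_ he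
        exact mul_le_mul_of_nonneg_right (by linarith) hl
    · rintro ⟨a, b, hab, hx, hl⟩
      exact hl.trans_le (le_dir hf hB x (by exact_mod_cast hab) hx)
  rw [this]
  refine MeasurableSet.iUnion fun a => MeasurableSet.iUnion fun b => MeasurableSet.iUnion fun _ =>
    measurableSet_Icc.prod ?_
  apply measurableSet_lt measurable_const
  simp only [setAverage_eq, smul_eq_mul]
  apply Measurable.const_mul
  have hm : StronglyMeasurable (fun p : ℝ × ℝ => |f (p.2, p.1)|) := by
    apply Measurable.stronglyMeasurable
    fun_prop
  exact (hm.integral_prod_right' (ν := volume.restrict (Icc (a:ℝ) b))).measurable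

end maxfun

/-- The strip of half-width `r` around the graph of `y`. -/
def strip (y : ℝ → ℝ) (r : ℝ) : Set (ℝ × ℝ) := {p | |p.2 - y p.1| ≤ r}

lemma strip_meas {y : ℝ → ℝ} (hy : Measurable y) (r : ℝ) : MeasurableSet (strip y r) := by
  unfold strip
  apply measurableSet_le _ measurable_const
  fun_prop

/-- The counting function of the nested dyadic strips. -/
noncomputable def cnt (N : ℕ) (y : ℝ → ℝ) (p : ℝ × ℝ) : ℝ :=
  ∑ k ∈ Finset.range N, (strip y ((1/2) ^ k)).indicator (fun _ => (1:ℝ)) p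

lemma cnt_meas {y : ℝ → ℝ} (hy : Measurable y) (N : ℕ) : Measurable (cnt N y) := by
  unfold cnt
  exact Finset.measurable_fun_sum _ fun k _ =>
    measurable_const.indicator (strip_meas hy _)

lemma ind_nonneg (s : Set (ℝ × ℝ)) (p : ℝ × ℝ) : 0 ≤ s.indicator (fun _ => (1:ℝ)) p :=
  indicator_nonneg (fun _ _ => zero_le_one) p

lemma ind_le (s : Set (ℝ × ℝ)) (p : ℝ × ℝ) : s.indicator (fun _ => (1:ℝ)) p ≤ 1 :=
  indicator_le_self' (fun _ _ => zero_le_one) p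

lemma cnt_nonneg (N : ℕ) (y : ℝ → ℝ) (p : ℝ × ℝ) : 0 ≤ cnt N y p :=
  Finset.sum_nonneg fun _ _ => ind_nonneg _ _

lemma cnt_abs (N : ℕ) (y : ℝ → ℝ) (p : ℝ × ℝ) : |cnt N y p| ≤ N := by
  rw [abs_of_nonneg (cnt_nonneg N y p)]
  calc cnt N y p ≤ ∑ k ∈ Finset.range N, (1:ℝ) := Finset.sum_le_sum fun _ _ => ind_le _ _
    _ = N := by simp

lemma cnt_eq {N : ℕ} {y : ℝ → ℝ} {p : ℝ × ℝ} (h : |p.2 - y p.1| ≤ (1/2) ^ N) :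
    cnt N y p = N := by
  unfold cnt
  rw [Finset.sum_congr rfl (g := fun _ => (1:ℝ))]
  · simp
  · intro k hk
    apply indicator_of_mem
    exact h.trans (pow_le_pow_of_le_one (by norm_num) (by norm_num) (Finset.mem_range.1 hk).le)

lemma cnt_zero {N : ℕ} {y : ℝ → ℝ} {p : ℝ × ℝ} (h : 1 < |p.2 - y p.1|) :
    cnt N y p = 0 := by
  apply Finset.sum_eq_zero
  intro k hk
  apply indicator_of_notMem
  intro hm
  have h1 : |p.2 - y p.1| ≤ (1/2) ^ k := hm
  have h2 : ((1:ℝ)/2) ^ k ≤ 1 := pow_le_one₀ (by norm_num) (by norm_num)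
  linarith

lemma strip_vol {y : ℝ → ℝ} (hy : Measurable y) {r : ℝ} (hr : 0 ≤ r) {a b c d : ℝ} (hab : a ≤ b) :
    ∫ p in Icc a b ×ˢ Icc c d, (strip y r).indicator (fun _ => (1:ℝ)) p ≤ (b - a) * (2 * r) := by
  rw [integral_indicator (strip_meas hy r), Measure.restrict_restrict (strip_meas hy r),
    setIntegral_const, smul_eq_mul, mul_one]
  apply ENNReal.toReal_le_of_le_ofReal
  · exact mul_nonneg (by linarith) (by linarith)
  have hms : MeasurableSet (strip y r ∩ Icc a b ×ˢ Icc c d) :=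
    (strip_meas hy r).inter (measurableSet_Icc.prod measurableSet_Icc)
  rw [Measure.volume_eq_prod, Measure.prod_apply hms]
  calc ∫⁻ x, volume (Prod.mk x ⁻¹' (strip y r ∩ Icc a b ×ˢ Icc c d))
      ≤ ∫⁻ x, (Icc a b).indicator (fun _ => ENNReal.ofReal (2 * r)) x := by
        apply lintegral_mono
        intro x
        dsimp only
        by_cases hx : x ∈ Icc a b
        · rw [indicator_of_mem hx]
          calc _ ≤ volume (Icc (y x - r) (y x + r)) := by
                apply measure_mono
                intro t ht
                have : |t - y x| ≤ r := ht.1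
                rw [abs_le] at this
                exact ⟨by linarith, by linarith⟩
            _ = _ := by rw [Real.volume_Icc]; congr 1; ring
        · rw [indicator_of_notMem hx]
          rw [nonpos_iff_eq_zero, show Prod.mk x ⁻¹' (strip y r ∩ Icc a b ×ˢ Icc c d) = ∅ from ?_]
          · simp
          · ext t
            simp only [mem_preimage, mem_inter_iff, mem_prod, mem_empty_iff_false, iff_false]
            tauto
    _ = ENNReal.ofReal ((b - a) * (2 * r)) := by
        rw [lintegral_indicator measurableSet_Icc, lintegral_const, Measure.restrict_apply_univ,
          Real.volume_Icc, mul_comm,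
          ENNReal.ofReal_mul (p := b - a) (by linarith)]

lemma ind_int {y : ℝ → ℝ} (hy : Measurable y) (r a b c d : ℝ) :
    IntegrableOn ((strip y r).indicator (fun _ => (1:ℝ))) (Icc a b ×ˢ Icc c d) :=
  (integrableOn_const (vol_rect_ne_top _ _ _ _)).indicator (strip_meas hy r)

lemma sum_vol {y : ℝ → ℝ} (hy : Measurable y) (A : Finset ℕ) {a b c d : ℝ} (hab : a ≤ b) :
    ∫ p in Icc a b ×ˢ Icc c d, ∑ k ∈ A, (strip y ((1/2)^k)).indicator (fun _ => (1:ℝ)) p ≤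
      (b - a) * (2 * ∑ k ∈ A, ((1:ℝ)/2)^k) := by
  rw [integral_finsetSum _ (fun k _ => ind_int hy _ a b c d), Finset.mul_sum, Finset.mul_sum]
  exact Finset.sum_le_sum fun k _ => strip_vol hy (by positivity) hab

lemma geom_tail (L : ℝ) (N : ℕ) :
    ∑ k ∈ Finset.range N with ((1:ℝ)/2)^k < L, ((1:ℝ)/2)^k ≤ max 0 (2 * L - 2 * (1/2)^N) := by
  induction N with
  | zero => simp
  | succ N ih =>
    have hp : (0:ℝ) < (1/2)^N := by positivity
    rw [Finset.sum_filter] at ih ⊢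
    rw [Finset.sum_range_succ, pow_succ]
    split_ifs with h
    · rw [max_eq_right (by linarith)] at ih
      exact le_max_of_le_right (by linarith)
    · rw [add_zero]
      exact ih.trans (max_le_max le_rfl (by linarith))

lemma geom_tail' {L : ℝ} (hL : 0 ≤ L) (N : ℕ) :
    ∑ k ∈ Finset.range N with ((1:ℝ)/2)^k < L, ((1:ℝ)/2)^k ≤ 2 * L := by
  refine (geom_tail L N).trans (max_le (by linarith) ?_)
  have hp : (0:ℝ) < (1/2)^N := by positivity
  linarith

/-- Among dyadic thresholds at least `L`, at most one separates values at distance at most `L`. -/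
lemma few_jumps_aux (A : Finset ℕ) {L u v : ℝ} (hA : ∀ k ∈ A, L ≤ ((1:ℝ)/2)^k) (h1 : u ≤ v)
    (h2 : v ≤ u + L) :
    (∑ k ∈ A, if u ≤ ((1:ℝ)/2)^k then (1:ℝ) else 0) -
      (∑ k ∈ A, if v ≤ ((1:ℝ)/2)^k then (1:ℝ) else 0) ≤ 1 := by
  rw [← Finset.sum_sub_distrib]
  have : ∀ k ∈ A, ((if u ≤ ((1:ℝ)/2)^k then (1:ℝ) else 0) - (if v ≤ ((1:ℝ)/2)^k then (1:ℝ) else 0))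
      ≤ if (u ≤ ((1:ℝ)/2)^k ∧ ((1:ℝ)/2)^k < v) then 1 else 0 := by
    intro k _
    by_cases hu : u ≤ ((1:ℝ)/2)^k <;> by_cases hv : v ≤ ((1:ℝ)/2)^k
    · rw [if_pos hu, if_pos hv, if_neg (fun h => not_lt.2 hv h.2)]; norm_num
    · rw [if_pos hu, if_neg hv, if_pos ⟨hu, not_le.1 hv⟩]; norm_num
    · exact absurd (h1.trans hv) hu
    · rw [if_neg hu, if_neg hv, if_neg (fun h => hu h.1)]; norm_num
  refine (Finset.sum_le_sum this).trans ?_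
  rw [← Finset.sum_filter, Finset.sum_const, nsmul_eq_mul, mul_one]
  have hc : (A.filter fun k => u ≤ ((1:ℝ)/2)^k ∧ ((1:ℝ)/2)^k < v).card ≤ 1 := by
    have hlt : ∀ i ∈ A, ∀ j ∈ A, u ≤ ((1:ℝ)/2)^i → u ≤ ((1:ℝ)/2)^j → ((1:ℝ)/2)^i < v → ¬ i < j := by
      intro i hi j hj hui huj hvi hij
      have h3 : ((1:ℝ)/2)^(j-1) ≤ (1/2)^i := 
        pow_le_pow_of_le_one (by norm_num) (by norm_num) (by omega)
      have h4 : ((1:ℝ)/2)^j = (1/2)^(j-1) * (1/2) := by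
        rw [← pow_succ]; congr 1; omega
      have := hA j hj
      linarith
    rw [Finset.card_le_one]
    intro i hi j hj
    rw [Finset.mem_filter] at hi hj
    have a1 := hlt i hi.1 j hj.1 hi.2.1 hj.2.1 hi.2.2
    have a2 := hlt j hj.1 i hi.1 hj.2.1 hi.2.1 hj.2.2
    omega
  exact_mod_cast hc

lemma few_jumps (A : Finset ℕ) {L u v : ℝ} (hA : ∀ k ∈ A, L ≤ ((1:ℝ)/2)^k) (h : |u - v| ≤ L) :
    |(∑ k ∈ A, if u ≤ ((1:ℝ)/2)^k then (1:ℝ) else 0) -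
      (∑ k ∈ A, if v ≤ ((1:ℝ)/2)^k then (1:ℝ) else 0)| ≤ 1 := by
  have mono : ∀ {u v : ℝ}, u ≤ v → (∑ k ∈ A, if v ≤ ((1:ℝ)/2)^k then (1:ℝ) else 0) ≤
      (∑ k ∈ A, if u ≤ ((1:ℝ)/2)^k then (1:ℝ) else 0) := by
    intro u v huv
    apply Finset.sum_le_sum
    intro k _
    split_ifs with h1 h2
    · exact le_rfl
    · exact absurd (huv.trans h1) h2
    · norm_num
    · exact le_rfl
  rw [abs_le] at h
  rcases le_total u v with huv | huv
  · rw [abs_of_nonneg (sub_nonneg.2 (mono huv))]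
    exact few_jumps_aux A hA huv (by linarith)
  · rw [abs_sub_comm, abs_of_nonneg (sub_nonneg.2 (mono huv))]
    exact few_jumps_aux A hA huv (by linarith)

lemma cnt_bmo {y : ℝ → ℝ} (hy : Measurable y) (hL : ∀ s t, |y s - y t| ≤ |s - t|) (N : ℕ) :
    bmo2 (cnt N y) ≤ ENNReal.ofReal 18 := by
  unfold bmo2
  refine iSup_le fun a => iSup_le fun b => iSup_le fun l => iSup_le fun hl =>
    ENNReal.ofReal_le_ofReal ?_
  set Q := Icc a (a + l) ×ˢ Icc b (b + l) with hQ
  have hvol : (volume : Measure (ℝ × ℝ)).real Q = l * l := by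
    rw [vol_rect _ _ _ _ (by linarith) (by linarith)]; ring
  let A := (Finset.range N).filter fun k => ((1:ℝ)/2)^k < 2 * l
  let A' := (Finset.range N).filter fun k => ¬ ((1:ℝ)/2)^k < 2 * l
  let c : ℝ := ∑ k ∈ A', if |b - y a| ≤ ((1:ℝ)/2)^k then (1:ℝ) else 0
  have hcint : IntegrableOn (cnt N y) Q :=
    integrableOn_bdd (vol_rect_ne_top _ _ _ _) (cnt_meas hy N) (cnt_abs N y)
  have hci : ∀ e : ℝ, IntegrableOn (fun _ : ℝ × ℝ => e) Q :=
    fun e => integrableOn_const (vol_rect_ne_top _ _ _ _)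
  have hsi : IntegrableOn (fun p => ∑ k ∈ A, (strip y ((1/2)^k)).indicator (fun _ => (1:ℝ)) p) Q :=
    integrable_finsetSum _ fun k _ => ind_int hy _ _ _ _ _
  have hpt : ∀ p ∈ Q, |cnt N y p - c| ≤
      1 + ∑ k ∈ A, (strip y ((1/2)^k)).indicator (fun _ => (1:ℝ)) p := by
    intro p hp
    have hsplit : cnt N y p = (∑ k ∈ A, (strip y ((1/2)^k)).indicator (fun _ => (1:ℝ)) p) +
        ∑ k ∈ A', if |p.2 - y p.1| ≤ ((1:ℝ)/2)^k then (1:ℝ) else 0 := by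
      unfold cnt
      rw [← Finset.sum_filter_add_sum_filter_not (Finset.range N) (fun k => ((1:ℝ)/2)^k < 2 * l)]
      congr 1
    have h1 : |(∑ k ∈ A', if |p.2 - y p.1| ≤ ((1:ℝ)/2)^k then (1:ℝ) else 0) - c| ≤ 1 := by
      apply few_jumps A' (L := 2 * l)
      · intro k hk
        exact not_lt.1 (Finset.mem_filter.1 hk).2
      · refine (abs_abs_sub_abs_le_abs_sub _ _).trans ?_
        have e1 := hL p.1 a
        obtain ⟨⟨h1, h2⟩, h3, h4⟩ := hp
        rw [abs_of_nonneg (sub_nonneg.2 h1)] at e1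
        rw [abs_le] at e1 ⊢
        constructor <;> linarith [e1.1, e1.2]
    have h2 : 0 ≤ ∑ k ∈ A, (strip y ((1/2)^k)).indicator (fun _ => (1:ℝ)) p :=
      Finset.sum_nonneg fun _ _ => ind_nonneg _ _
    rw [hsplit]
    rw [abs_le] at h1 ⊢
    constructor <;> linarith [h1.1, h1.2]
  have := osc_le (f := cnt N y) (s := Q) (c := c) (D := 9) (vol_rect_ne_top _ _ _ _)
    (by rw [hvol]; positivity) hcint ?_
  · linarith
  calc ∫ p in Q, |cnt N y p - c|
      ≤ ∫ p in Q, (1 + ∑ k ∈ A, (strip y ((1/2)^k)).indicator (fun _ => (1:ℝ)) p) :=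
        setIntegral_mono_on (hcint.sub (hci c)).abs ((hci 1).add hsi)
          (measurableSet_Icc.prod measurableSet_Icc) hpt
    _ = l * l + ∫ p in Q, ∑ k ∈ A, (strip y ((1/2)^k)).indicator (fun _ => (1:ℝ)) p := by
        rw [integral_add (hci 1) hsi, setIntegral_const, hvol, smul_eq_mul, mul_one]
    _ ≤ l * l + (a + l - a) * (2 * ∑ k ∈ A, ((1:ℝ)/2)^k) := by
        gcongr
        exact sum_vol hy A (by linarith)
    _ ≤ l * l + l * (2 * (2 * (2 * l))) := by
        rw [add_sub_cancel_left]
        gcongr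
        exact geom_tail' (by linarith) N
    _ = 9 * (volume : Measure (ℝ × ℝ)).real Q := by rw [hvol]; ring

/-- Upper bounds away from the graph. -/
lemma dir_upper {y : ℝ → ℝ} (hy1 : ∀ s, y s ≤ 1) (N : ℕ) {p : ℝ × ℝ}
    (hp : p ∈ Icc (0:ℝ) 4 ×ˢ Icc (3:ℝ) 4) : dirMax (cnt N y) p ≤ 4 := by
  apply csSup_le (dir_ne p)
  rintro r ⟨a, b, hab, hx, rfl⟩
  have : ∀ t, cnt N y (t, p.2) = 0 := fun t => cnt_zero (lt_of_lt_of_le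
    (by linarith [hp.2.1, hy1 t]) (le_abs_self _))
  simp [this]

lemma str_upper {y : ℝ → ℝ} (hy : Measurable y) (hy1 : ∀ s, y s ≤ 1) (N : ℕ) {p : ℝ × ℝ}
    (hp : p ∈ Icc (0:ℝ) 4 ×ˢ Icc (3:ℝ) 4) : strongMax (cnt N y) p ≤ 4 := by
  apply csSup_le (str_ne p)
  rintro r ⟨a, b, c, d, hab, hcd, hx, rfl⟩
  simp only [abs_of_nonneg (cnt_nonneg _ _ _)]
  have hi : IntegrableOn (cnt N y) (Icc a b ×ˢ Icc c d) :=
    integrableOn_bdd (vol_rect_ne_top _ _ _ _) (cnt_meas hy N) (cnt_abs N y)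
  rcases lt_or_ge (d - c) 1 with h | h
  · apply avg_le (vol_rect_ne_top _ _ _ _) (by norm_num)
      (measurableSet_Icc.prod measurableSet_Icc) hi
    intro q hq
    rw [cnt_zero]
    · norm_num
    · refine lt_of_lt_of_le ?_ (le_abs_self _)
      linarith [hp.2.1, hy1 q.1, hq.2.1, hx.2.2]
  · have h1 := sum_vol hy (Finset.range N) (c := c) (d := d) hab.le
    have h2 : ∑ k ∈ Finset.range N, ((1:ℝ)/2)^k ≤ 2 := sum_geometric_two_le N
    rw [setAverage_eq, smul_eq_mul, vol_rect _ _ _ _ hab.le hcd.le,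
      inv_mul_le_iff₀ (mul_pos (by linarith) (by linarith))]
    unfold cnt
    refine h1.trans ?_
    rw [mul_assoc]
    apply mul_le_mul_of_nonneg_left _ (by linarith)
    linarith

/-- The slowly varying profile. -/
noncomputable def prof (N : ℕ) (x : ℝ) : ℝ := min 1 ((1/2)^N / 6 * Real.log (max 1 x))

lemma prof_meas (N : ℕ) : Measurable (prof N) := by
  unfold prof
  fun_prop

lemma prof_le (N : ℕ) (s : ℝ) : prof N s ≤ 1 := min_le_left _ _

lemma log_lip {s t : ℝ} (hs : 1 ≤ s) (hst : s ≤ t) : Real.log t - Real.log s ≤ t - s := by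
  rw [← Real.log_div (by linarith) (by linarith)]
  refine (Real.log_le_sub_one_of_pos (div_pos (by linarith) (by linarith))).trans ?_
  rw [div_sub_one (by linarith), div_le_iff₀ (by linarith)]
  nlinarith

lemma prof_lip_aux (N : ℕ) {s t : ℝ} (hst : s ≤ t) :
    prof N s ≤ prof N t ∧ prof N t ≤ prof N s + (t - s) := by
  have e0 : (0:ℝ) ≤ (1/2)^N / 6 := by positivity
  have e1 : ((1:ℝ)/2)^N / 6 ≤ 1 := by
    have : ((1:ℝ)/2)^N ≤ 1 := pow_le_one₀ (by norm_num) (by norm_num)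
    linarith
  have hm : max 1 s ≤ max 1 t := max_le_max le_rfl hst
  have h1 : (1:ℝ) ≤ max 1 s := le_max_left _ _
  have hm2 : max 1 t - max 1 s ≤ t - s := by
    have : max 1 t ≤ max 1 s + (t - s) :=
      max_le (by linarith) (by linarith [le_max_right 1 s])
    linarith
  have hl := log_lip h1 hm
  have hl0 : Real.log (max 1 s) ≤ Real.log (max 1 t) := Real.log_le_log (by linarith) hm
  unfold prof
  constructor
  · exact min_le_min le_rfl (mul_le_mul_of_nonneg_left hl0 e0)
  · rw [← min_add_add_right]
    refine min_le_min (by linarith) ?_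
    nlinarith

lemma prof_lip (N : ℕ) (s t : ℝ) : |prof N s - prof N t| ≤ |s - t| := by
  rcases le_total s t with h | h
  · obtain ⟨h1, h2⟩ := prof_lip_aux N h
    rw [abs_of_nonpos (by linarith), abs_of_nonpos (by linarith)]; linarith
  · obtain ⟨h1, h2⟩ := prof_lip_aux N h
    rw [abs_of_nonneg (by linarith), abs_of_nonneg (by linarith)]; linarith

lemma prof_near (N : ℕ) {t : ℝ} (ht : t ∈ Icc (0:ℝ) 1) :
    ∃ a : ℝ, 1 ≤ a ∧ ∀ x ∈ Icc (4 * a) (8 * a), t ≤ prof N x ∧ prof N x ≤ t + (1/2)^N / 2 := by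
  have e0 : (0:ℝ) < (1/2)^N / 6 := by positivity
  refine ⟨Real.exp (t / ((1/2)^N / 6)), Real.one_le_exp (div_nonneg ht.1 e0.le), ?_⟩
  intro x hx
  set a := Real.exp (t / ((1/2)^N / 6)) with ha
  have ha1 : 1 ≤ a := Real.one_le_exp (div_nonneg ht.1 e0.le)
  have hla : ((1:ℝ)/2)^N / 6 * Real.log a = t := by
    rw [ha, Real.log_exp]; field_simp
  have hx1 : max 1 x = x := max_eq_right (by linarith [hx.1])
  have l1 : Real.log a ≤ Real.log x := Real.log_le_log (by linarith) (by linarith [hx.1])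
  have l2 : Real.log x ≤ Real.log a + 3 := by
    have : Real.log x ≤ Real.log (8 * a) := Real.log_le_log (by linarith [hx.1]) hx.2
    rw [Real.log_mul (by norm_num) (by linarith), show (8:ℝ) = 2^3 by norm_num, Real.log_pow] at this
    have := Real.log_two_lt_d9
    push_cast at *
    linarith
  unfold prof
  rw [hx1]
  constructor
  · refine le_min ht.2 ?_
    rw [← hla]
    exact mul_le_mul_of_nonneg_left l1 e0.le
  · refine (min_le_right _ _).trans ?_
    have := mul_le_mul_of_nonneg_left l2 e0.le
    rw [mul_add, hla] at this
    linarith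

lemma dir_lower (N : ℕ) {p : ℝ × ℝ} (hp : p ∈ Icc (0:ℝ) 4 ×ˢ Icc (0:ℝ) 1) :
    (N:ℝ) / 2 ≤ dirMax (cnt N (prof N)) p := by
  obtain ⟨a, ha, h⟩ := prof_near N hp.2
  have hpow : (0:ℝ) < (1/2)^N := by positivity
  refine le_trans ?_ (le_dir (cnt_meas (prof_meas N) N) (cnt_abs N _) p (a := 0) (b := 8 * a)
    (by linarith) ⟨hp.1.1, by linarith [hp.1.2]⟩)
  rw [setAverage_eq, smul_eq_mul, Real.volume_real_Icc_of_le (by linarith), sub_zero,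
    le_inv_mul_iff₀ (by linarith)]
  have hi := slice_int (cnt_meas (prof_meas N) N) (cnt_abs N (prof N)) p.2
  have h1 : ∫ t in Icc (4 * a) (8 * a), |cnt N (prof N) (t, p.2)| = 4 * a * N := by
    rw [setIntegral_congr_fun (g := fun _ => (N:ℝ)) measurableSet_Icc]
    · rw [setIntegral_const, Real.volume_real_Icc_of_le (by linarith), smul_eq_mul]; ring
    · intro t ht
      dsimp only
      rw [cnt_eq, Nat.abs_cast]
      have := h t ht
      rw [abs_le]
      constructor <;> linarith [this.1, this.2]
  have h2 := setIntegral_mono_set (hi 0 (8 * a)) (Eventually.of_forall fun p => abs_nonneg _)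
    (LE.le.eventuallyLE (Icc_subset_Icc_left (by linarith) : Icc (4 * a) (8 * a) ⊆ Icc 0 (8 * a)))
    (μ := volume)
  rw [h1] at h2
  linarith

lemma str_lower (N : ℕ) {p : ℝ × ℝ} (hp : p ∈ Icc (0:ℝ) 4 ×ˢ Icc (0:ℝ) 1) :
    (N:ℝ) / 2 ≤ strongMax (cnt N (prof N)) p := by
  obtain ⟨a, ha, h⟩ := prof_near N hp.2
  have hpow : (0:ℝ) < (1/2)^N := by positivity
  set w : ℝ := (1/2)^N with hw
  refine le_trans ?_ (le_str (cnt_meas (prof_meas N) N) (cnt_abs N _) p (a := 0) (b := 8 * a)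
    (c := p.2) (d := p.2 + w)
    (by linarith) (by linarith) ⟨⟨hp.1.1, by linarith [hp.1.2]⟩, le_rfl, by linarith⟩)
  rw [setAverage_eq, smul_eq_mul, vol_rect _ _ _ _ (by linarith) (by linarith),
    le_inv_mul_iff₀ (mul_pos (by linarith) (by linarith))]
  have hi := rect_int (cnt_meas (prof_meas N) N) (cnt_abs N (prof N))
  have h1 : ∫ q in Icc (4 * a) (8 * a) ×ˢ Icc p.2 (p.2 + w), |cnt N (prof N) q|
      = 4 * a * w * N := by
    rw [setIntegral_congr_fun (g := fun _ => (N:ℝ)) (measurableSet_Icc.prod measurableSet_Icc)]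
    · rw [setIntegral_const, vol_rect _ _ _ _ (by linarith) (by linarith), smul_eq_mul]; ring
    · intro q hq
      dsimp only
      rw [cnt_eq, Nat.abs_cast]
      have := h q.1 hq.1
      obtain ⟨_, h3, h4⟩ := hq
      rw [abs_le, ← hw]
      constructor <;> linarith [this.1, this.2]
  have h2 := setIntegral_mono_set (hi 0 (8 * a) p.2 (p.2 + w))
    (Eventually.of_forall fun p => abs_nonneg _)
    (LE.le.eventuallyLE (prod_mono_left (Icc_subset_Icc_left (by linarith)) :
      Icc (4 * a) (8 * a) ×ˢ Icc p.2 (p.2 + w) ⊆ Icc 0 (8 * a) ×ˢ Icc p.2 (p.2 + w)))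
    (μ := volume)
  rw [h1] at h2
  linarith

lemma tendsto_aux {u : ℕ → ℝ≥0∞} (h : ∀ N : ℕ, ENNReal.ofReal (((N:ℝ) / 2 - 4) / 4) ≤ u N) :
    Tendsto u atTop (𝓝 ⊤) := by
  have h1 : Tendsto (fun N : ℕ => ((N:ℝ) / 2 - 4) / 4) atTop atTop := by
    apply Tendsto.atTop_div_const (by norm_num)
    apply tendsto_atTop_add_const_right
    exact tendsto_natCast_atTop_atTop.atTop_div_const (by norm_num)
  exact tendsto_nhds_top_mono (ENNReal.tendsto_ofReal_atTop.comp h1) (Eventually.of_forall h)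

end BmoAux

/-- there is a sequence of bounded measurable functions `G_N` on ℝ²,
uniformly bounded in `BMO(ℝ²)`, such that `‖M_{e₁}(G_N)‖_{BMO(ℝ²)} → ∞` and
`‖M_s(G_N)‖_{BMO(ℝ²)} → ∞`; in particular neither the directional nor the strong
maximal operator is bounded on `BMO(ℝ²)`, even on bounded functions. -/
theorem directional_and_strong_maximal_unbounded_on_bmo :
    ∃ (G : ℕ → ℝ × ℝ → ℝ) (C : ℝ),
      (∀ N, Measurable (G N)) ∧
      (∀ N, ∃ B : ℝ, ∀ p, |G N p| ≤ B) ∧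
      (∀ N, bmo2 (G N) ≤ ENNReal.ofReal C) ∧
      Tendsto (fun N => bmo2 (dirMax (G N))) atTop (𝓝 ⊤) ∧
      Tendsto (fun N => bmo2 (strongMax (G N))) atTop (𝓝 ⊤) := by
  refine ⟨fun N => BmoAux.cnt N (BmoAux.prof N), 18, fun N => BmoAux.cnt_meas (BmoAux.prof_meas N) N,
    fun N => ⟨N, BmoAux.cnt_abs N _⟩,
    fun N => BmoAux.cnt_bmo (BmoAux.prof_meas N) (BmoAux.prof_lip N) N, ?_, ?_⟩
  · apply BmoAux.tendsto_aux
    intro N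
    have hm := BmoAux.cnt_meas (BmoAux.prof_meas N) N
    exact BmoAux.bmo_lower (BmoAux.dir_meas hm (BmoAux.cnt_abs N _))
      (BmoAux.dir_abs hm (BmoAux.cnt_abs N _)) (fun p hp => BmoAux.dir_lower N hp)
      (fun p hp => BmoAux.dir_upper (BmoAux.prof_le N) N hp)
  · apply BmoAux.tendsto_aux
    intro N
    have hm := BmoAux.cnt_meas (BmoAux.prof_meas N) N
    exact BmoAux.bmo_lower (BmoAux.str_meas hm (BmoAux.cnt_abs N _))
      (BmoAux.str_abs hm (BmoAux.cnt_abs N _)) (fun p hp => BmoAux.str_lower N hp)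
      (fun p hp => BmoAux.str_upper (BmoAux.prof_meas N) (BmoAux.prof_le N) N hp)
end
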